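/- arXiv:2409.08120 — 6 statements merged into one kernel-verified Lean document; each statement's English description precedes it below -/
import Mathlib

section
/- Let D be a bounded Lipschitz domain in R^d and α ∈ (1,2). There exists a constant C > 0 such that for every s, ε ∈ (0,1) and every x ∈ D with dist(x, ∂D) > 4ε, one has ∫_{|z|>sε} 1_{{x+z ∈ D, dist(x+z,∂D) ≤ 3ε}} |z|^{-(d+α-1)} dz ≤ C ε · dist(x,∂D)^{-α}. -/
noncomputable section
open MeasureTheory Metric Set Filter Topology

/-- A bounded Lipschitz domain in `ℝ^d`, encoded via openness, boundedness and the
uniform interior cone condition (which characterizes Lipschitz domains among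
bounded open sets). -/
def IsBoundedLipschitzDomain {d : ℕ} (D : Set (EuclideanSpace ℝ (Fin d))) : Prop :=
  IsOpen D ∧ Bornology.IsBounded D ∧
    ∃ r h : ℝ, 0 < r ∧ 0 < h ∧
      ∀ p ∈ frontier D, ∃ v : EuclideanSpace ℝ (Fin d), ‖v‖ = 1 ∧
        ∀ x ∈ Metric.ball p r ∩ closure D, ∀ t ∈ Set.Ioc (0 : ℝ) h,
          ∀ y ∈ Metric.ball (x + t • v) (r * t), y ∈ D

theorem le_infDist_frontier_of_cone {d : ℕ} {D : Set (EuclideanSpace ℝ (Fin d))}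
    (hD : IsOpen D) (hne : (frontier D).Nonempty) {r t : ℝ}
    {v y : EuclideanSpace ℝ (Fin d)} (hcone : Metric.ball (y + t • v) (r * t) ⊆ D) :
    r * t ≤ Metric.infDist (y + t • v) (frontier D) := by
  refine (Metric.le_infDist hne).2 fun q hq => ?_
  by_contra! hlt
  have hqD : q ∈ D := hcone (by rwa [Metric.mem_ball, dist_comm])
  rw [hD.frontier_eq] at hq
  exact hq.2 hqD

/-- Disjoint translates of a boundary layer in the cone direction bound its volume. -/
theorem volume_layer_mul_le {d : ℕ} {D : Set (EuclideanSpace ℝ (Fin d))}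
    (hD : IsOpen D) (hne : (frontier D).Nonempty) {r h η τ R : ℝ}
    {v x : EuclideanSpace ℝ (Fin d)} {L : Set (EuclideanSpace ℝ (Fin d))}
    (hv : ‖v‖ = 1) (hr : 0 < r) (hτ : 0 < τ) (hητ : η < r * τ) (hR : 0 < R) (hRh : R ≤ h)
    (hL : MeasurableSet L) (hLx : L ⊆ Metric.ball x R)
    (hcone : ∀ y ∈ L, ∀ t ∈ Set.Ioc (0 : ℝ) h, Metric.ball (y + t • v) (r * t) ⊆ D)
    (hLη : ∀ y ∈ L, Metric.infDist y (frontier D) ≤ η) :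
    ENNReal.ofReal (R / τ) * volume L ≤ volume (Metric.ball x (2 * R)) := by
  set N := ⌊R / τ⌋₊ with hN
  have hNle : (N : ℝ) * τ ≤ R := by
    rw [← le_div_iff₀ hτ]
    exact Nat.floor_le (by positivity)
  have key : ∀ i j : ℕ, i < j → j ≤ N → ∀ y ∈ L, ∀ y' ∈ L,
      -((i * τ) • v) + y = -((j * τ) • v) + y' → False := by
    intro i j hij hj y hy y' hy' he
    have hjN : (j : ℝ) ≤ N := by exact_mod_cast hj
    have hij' : (i : ℝ) + 1 ≤ j := by exact_mod_cast hij
    have hi0 : (0 : ℝ) ≤ i := Nat.cast_nonneg i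
    have e : y' = y + ((j - i : ℝ) * τ) • v := by
      rw [sub_mul, sub_smul]
      linear_combination (norm := module) -he
    have ht : ((j - i : ℝ) * τ) ∈ Set.Ioc (0 : ℝ) h :=
      ⟨mul_pos (by linarith) hτ, by nlinarith⟩
    have h1 := le_infDist_frontier_of_cone hD hne (hcone y hy _ ht)
    rw [← e] at h1
    have h2 := hLη y' hy'
    have h3 : τ ≤ (j - i : ℝ) * τ := by nlinarith
    nlinarith
  have hdisj : Set.PairwiseDisjoint (↑(Finset.range (N + 1)))
      (fun k : ℕ => (fun z => ((k * τ) • v) + z) ⁻¹' L) := by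
    intro i hi j hj hij
    rw [Finset.coe_range, Set.mem_Iio] at hi hj
    refine Set.disjoint_left.2 fun z hzi hzj => ?_
    rcases lt_or_gt_of_ne hij with hlt | hlt
    · exact key i j hlt (by omega) _ hzi _ hzj (by simp)
    · exact key j i hlt (by omega) _ hzj _ hzi (by simp)
  have hmeas : ∀ k ∈ Finset.range (N + 1),
      MeasurableSet ((fun z => (((k : ℕ) * τ) • v) + z) ⁻¹' L) := fun k _ =>
    hL.preimage (measurable_const_add _)
  have hsum := measure_biUnion_finset (μ := volume) hdisj hmeas
  simp only [measure_preimage_add, Finset.sum_const, Finset.card_range, nsmul_eq_mul] at hsum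
  calc ENNReal.ofReal (R / τ) * volume L
      ≤ ((N + 1 : ℕ) : ENNReal) * volume L := by
        gcongr
        rw [← ENNReal.ofReal_natCast]
        apply ENNReal.ofReal_le_ofReal
        push_cast
        exact (Nat.lt_floor_add_one _).le
    _ = _ := hsum.symm
    _ ≤ _ := by
        apply measure_mono
        refine Set.iUnion₂_subset fun k hk z hz => ?_
        have hk' : (k : ℝ) ≤ N := by exact_mod_cast Nat.lt_succ_iff.1 (Finset.mem_range.1 hk)
        have h1 := hLx hz
        rw [mem_ball_iff_norm] at h1 ⊢
        have h2 : ‖((k : ℝ) * τ) • v‖ ≤ R := by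
          rw [norm_smul, hv, mul_one, Real.norm_of_nonneg (by positivity)]
          nlinarith
        have h3 : z - x = ((((k : ℝ) * τ) • v + z) - x) - ((k : ℝ) * τ) • v := by abel
        rw [h3]
        linarith [norm_sub_le ((((k : ℝ) * τ) • v + z) - x) (((k : ℝ) * τ) • v)]

/-- The part of `D` at distance at most `η` from the boundary. -/
def boundaryLayer {d : ℕ} (D : Set (EuclideanSpace ℝ (Fin d))) (η : ℝ) :
    Set (EuclideanSpace ℝ (Fin d)) :=
  {y | y ∈ D ∧ Metric.infDist y (frontier D) ≤ η}

theorem volume_boundaryLayer_inter_ball_le_of_small {d : ℕ} (hd : 0 < d)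
    {D : Set (EuclideanSpace ℝ (Fin d))} (hD : IsBoundedLipschitzDomain D)
    (hne : (frontier D).Nonempty) :
    ∃ C R₀ : ℝ, 0 < C ∧ 0 < R₀ ∧ ∀ η R : ℝ, ∀ x, 0 < η → 0 < R → R ≤ R₀ →
      volume (boundaryLayer D η ∩ Metric.ball x R) ≤ ENNReal.ofReal (C * η * R ^ (d - 1)) := by
  obtain ⟨hopen, hbdd, r, h, hr, hh, hcone⟩ := hD
  set V : ℝ := (volume (Metric.ball (0 : EuclideanSpace ℝ (Fin d)) 1)).toReal with hV
  have hball : ∀ (x : EuclideanSpace ℝ (Fin d)) {R : ℝ}, 0 < R →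
      volume (Metric.ball x R) = ENNReal.ofReal (R ^ d * V) := by
    intro x R hR
    rw [Measure.addHaar_ball_of_pos _ _ hR, finrank_euclideanSpace_fin,
      ENNReal.ofReal_mul (by positivity), hV, ENNReal.ofReal_toReal measure_ball_lt_top.ne]
  have hV0 : 0 < V :=
    ENNReal.toReal_pos (measure_ball_pos _ _ one_pos).ne' measure_ball_lt_top.ne
  have hpow : ∀ R : ℝ, R ^ d = R ^ (d - 1) * R := fun R => by
    rw [← pow_succ, Nat.sub_add_cancel hd]
  refine ⟨2 * (2 ^ d + h) / r * V, min h (r / 8), by positivity, by positivity, ?_⟩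
  intro η R x hη hR hR0
  have hRh : R ≤ h := hR0.trans (min_le_left _ _)
  have hRr : R ≤ r / 8 := hR0.trans (min_le_right _ _)
  rcases le_or_gt (r / 2) η with hbig | hsmall
  · refine (measure_mono Set.inter_subset_right).trans ?_
    rw [hball x hR]
    apply ENNReal.ofReal_le_ofReal
    have h1 : 1 ≤ 2 * η / r := by rw [le_div_iff₀ hr]; linarith
    calc R ^ d * V = V * R ^ (d - 1) * R := by rw [hpow]; ring
      _ ≤ V * R ^ (d - 1) * ((2 ^ d + h) * (2 * η / r)) := by
          gcongr
          nlinarith [pow_pos (two_pos : (0 : ℝ) < 2) d]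
      _ = _ := by ring
  rcases (boundaryLayer D η ∩ Metric.ball x R).eq_empty_or_nonempty with hE | ⟨y, hy, hyx⟩
  · simp [hE]
  obtain ⟨q, hq, hyq⟩ := isClosed_frontier.exists_infDist_eq_dist hne y
  have hyq' : dist y q ≤ η := hyq ▸ hy.2
  obtain ⟨v, hv, hcv⟩ := hcone q hq
  have hmeas : MeasurableSet (boundaryLayer D η ∩ Metric.ball x R) :=
    (hopen.measurableSet.inter
      (measurableSet_le (Metric.continuous_infDist_pt _).measurable measurable_const)).inter
      measurableSet_ball
  have hmain := volume_layer_mul_le hopen hne (η := η) (τ := 2 * η / r) (r := r) (h := h)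
    hv hr (by positivity) (by rw [mul_div_cancel₀ _ hr.ne']; linarith) hR hRh hmeas
    Set.inter_subset_right
    (fun w hw t ht u hu => by
      refine hcv w ⟨?_, subset_closure hw.1.1⟩ t ht u hu
      have h1 := hw.2
      rw [Metric.mem_ball] at h1 hyx ⊢
      have := dist_triangle4 w x y q
      rw [dist_comm x y] at this
      linarith)
    (fun w hw => hw.1.2)
  rw [hball x (by positivity)] at hmain
  have hc : 0 < R / (2 * η / r) := by positivity
  rw [mul_comm, ← ENNReal.le_div_iff_mul_le (by left; simpa using hc) (by left; simp),
    ← ENNReal.ofReal_div_of_pos hc] at hmain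
  refine hmain.trans (ENNReal.ofReal_le_ofReal ?_)
  calc (2 * R) ^ d * V / (R / (2 * η / r)) = 2 * 2 ^ d / r * V * η * R ^ (d - 1) := by
        rw [mul_pow, hpow R]
        field_simp
    _ ≤ 2 * (2 ^ d + h) / r * V * η * R ^ (d - 1) := by
        gcongr
        linarith

theorem volume_boundaryLayer_inter_ball_le {d : ℕ} (hd : 0 < d)
    {D : Set (EuclideanSpace ℝ (Fin d))} (hD : IsBoundedLipschitzDomain D)
    (hne : (frontier D).Nonempty) :
    ∃ C : ℝ, 0 < C ∧ ∀ η R : ℝ, ∀ x, 0 < η → 0 < R →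
      volume (boundaryLayer D η ∩ Metric.ball x R) ≤ ENNReal.ofReal (C * η * R ^ (d - 1)) := by
  obtain ⟨C, R₀, hC, hR₀, hsmall⟩ := volume_boundaryLayer_inter_ball_le_of_small hd hD hne
  obtain ⟨t, ht, hDt⟩ := Metric.totallyBounded_iff.1
    ((Bornology.IsBounded.isCompact_closure hD.2.1).totallyBounded.subset subset_closure) R₀ hR₀
  lift t to Finset (EuclideanSpace ℝ (Fin d)) using ht
  refine ⟨C * (t.card + 1), by positivity, fun η R x hη hR => ?_⟩
  rcases le_total R R₀ with hle | hle
  · refine (hsmall η R x hη hR hle).trans (ENNReal.ofReal_le_ofReal ?_)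
    gcongr
    exact le_mul_of_one_le_right hC.le (by simp)
  calc volume (boundaryLayer D η ∩ Metric.ball x R)
      ≤ volume (⋃ y ∈ t, boundaryLayer D η ∩ Metric.ball y R₀) := by
        refine measure_mono fun z hz => ?_
        have := hDt hz.1.1
        simp only [Set.mem_iUnion, Finset.mem_coe] at this ⊢
        obtain ⟨y, hy, hzy⟩ := this
        exact ⟨y, hy, hz.1, hzy⟩
    _ ≤ ∑ y ∈ t, volume (boundaryLayer D η ∩ Metric.ball y R₀) := measure_biUnion_finset_le _ _
    _ ≤ ∑ y ∈ t, ENNReal.ofReal (C * η * R₀ ^ (d - 1)) :=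
        Finset.sum_le_sum fun y _ => hsmall η R₀ y hη hR₀ le_rfl
    _ = ENNReal.ofReal (t.card * (C * η * R₀ ^ (d - 1))) := by
        rw [Finset.sum_const, nsmul_eq_mul, ENNReal.ofReal_mul (Nat.cast_nonneg t.card),
          ENNReal.ofReal_natCast]
    _ ≤ _ := by
        apply ENNReal.ofReal_le_ofReal
        calc t.card * (C * η * R₀ ^ (d - 1)) = C * t.card * η * R₀ ^ (d - 1) := by ring
          _ ≤ C * (t.card + 1) * η * R ^ (d - 1) := by
            gcongr
            linarith

/-- Dyadic summation: a set with `(d - 1)`-dimensional volume growth, at distance at least `a`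
from `x`, has kernel integral of order `a ^ (-α)`. -/
theorem lintegral_indicator_norm_rpow_le {d : ℕ} (hd : 0 < d) {α M a : ℝ} (hα : 0 < α)
    (hM : 0 ≤ M) (ha : 0 < a) {x : EuclideanSpace ℝ (Fin d)} {S : Set (EuclideanSpace ℝ (Fin d))}
    (hS : MeasurableSet S)
    (hvol : ∀ R : ℝ, 0 < R → volume (S ∩ Metric.ball x R) ≤ ENNReal.ofReal (M * R ^ (d - 1)))
    (hfar : ∀ z, x + z ∈ S → a ≤ ‖z‖) :
    ∫⁻ z, Set.indicator {z | x + z ∈ S}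
        (fun z => ENNReal.ofReal (‖z‖ ^ (-((d : ℝ) + α - 1)))) z
      ≤ ENNReal.ofReal (M * 2 ^ (d - 1) * a ^ (-α) * (1 - 2 ^ (-α))⁻¹) := by
  have hβ : -((d : ℝ) + α - 1) ≤ 0 := by
    have : (1 : ℝ) ≤ d := by exact_mod_cast hd
    linarith
  set A : ℕ → Set (EuclideanSpace ℝ (Fin d)) := fun k =>
    (fun z => x + z) ⁻¹' (S ∩ Metric.ball x (2 ^ (k + 1) * a)) with hA
  have hAm : ∀ k, MeasurableSet (A k) := fun k =>
    (hS.inter measurableSet_ball).preimage (measurable_const_add x)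
  set c : ℕ → ENNReal := fun k => ENNReal.ofReal ((2 ^ k * a) ^ (-((d : ℝ) + α - 1))) with hc
  have hq0 : (0 : ℝ) ≤ 2 ^ (-α) := by positivity
  have hq1 : (2 : ℝ) ^ (-α) < 1 := Real.rpow_lt_one_of_one_lt_of_neg one_lt_two (by linarith)
  calc ∫⁻ z, Set.indicator {z | x + z ∈ S}
        (fun z => ENNReal.ofReal (‖z‖ ^ (-((d : ℝ) + α - 1)))) z
      ≤ ∫⁻ z, ∑' k, (A k).indicator (fun _ => c k) z := by
        refine lintegral_mono fun z => Set.indicator_apply_le' (fun hz => ?_) fun _ => zero_le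
        have hza := hfar z hz
        obtain ⟨k, hk1, hk2⟩ := exists_nat_pow_near ((one_le_div ha).2 hza) one_lt_two
        rw [le_div_iff₀ ha] at hk1
        rw [div_lt_iff₀ ha] at hk2
        have hzA : z ∈ A k := ⟨hz, by simpa using hk2⟩
        refine le_trans ?_ (ENNReal.le_tsum k)
        rw [Set.indicator_of_mem hzA]
        exact ENNReal.ofReal_le_ofReal
          (Real.rpow_le_rpow_of_nonpos (by positivity) hk1 hβ)
    _ = ∑' k, c k * volume (A k) := by
        rw [lintegral_tsum fun k => (measurable_const.indicator (hAm k)).aemeasurable]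
        simp_rw [lintegral_indicator_const (hAm _)]
    _ ≤ ∑' k, ENNReal.ofReal (M * 2 ^ (d - 1) * a ^ (-α) * (2 ^ (-α)) ^ k) := by
        refine ENNReal.tsum_le_tsum fun k => ?_
        have hb : (0 : ℝ) < 2 ^ k * a := by positivity
        calc c k * volume (A k)
            ≤ c k * ENNReal.ofReal (M * (2 ^ (k + 1) * a) ^ (d - 1)) := by
              gcongr
              rw [hA, measure_preimage_add]
              exact hvol _ (by positivity)
          _ = _ := by
              rw [hc, ← ENNReal.ofReal_mul (by positivity)]
              congr 1
              have h1 : (2 ^ k * a) ^ (-((d : ℝ) + α - 1)) * (2 ^ k * a) ^ (d - 1)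
                  = (2 ^ k * a) ^ (-α) := by
                rw [← Real.rpow_natCast (2 ^ k * a) (d - 1), ← Real.rpow_add hb,
                  Nat.cast_sub hd]
                congr 1
                push_cast
                ring
              have h2 : ((2 : ℝ) ^ k * a) ^ (-α) = (2 ^ (-α)) ^ k * a ^ (-α) := by
                rw [Real.mul_rpow (by positivity) ha.le, ← Real.rpow_natCast_mul two_pos.le,
                  mul_comm (k : ℝ), Real.rpow_mul_natCast two_pos.le]
              calc (2 ^ k * a) ^ (-((d : ℝ) + α - 1)) * (M * (2 ^ (k + 1) * a) ^ (d - 1))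
                  = M * 2 ^ (d - 1) *
                    ((2 ^ k * a) ^ (-((d : ℝ) + α - 1)) * (2 ^ k * a) ^ (d - 1)) := by
                    rw [pow_succ, mul_comm ((2 : ℝ) ^ k) 2, mul_assoc 2, mul_pow 2]
                    ring
                _ = _ := by rw [h1, h2]; ring
    _ = _ := by
        rw [← ENNReal.ofReal_tsum_of_nonneg (fun k => by positivity)
          ((summable_geometric_of_lt_one hq0 hq1).mul_left _), tsum_mul_left,
          tsum_geometric_of_lt_one hq0 hq1]

theorem stmt_0 {d : ℕ} (hd : 0 < d) {D : Set (EuclideanSpace ℝ (Fin d))}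
    (hD : IsBoundedLipschitzDomain D) {α : ℝ} (hα : α ∈ Set.Ioo (1 : ℝ) 2) :
    ∃ C : ℝ, 0 < C ∧
      ∀ s ∈ Set.Ioo (0 : ℝ) 1, ∀ ε ∈ Set.Ioo (0 : ℝ) 1, ∀ x ∈ D,
        4 * ε < Metric.infDist x (frontier D) →
        (∫ z in {z : EuclideanSpace ℝ (Fin d) | s * ε < ‖z‖},
            Set.indicator {z : EuclideanSpace ℝ (Fin d) |
                x + z ∈ D ∧ Metric.infDist (x + z) (frontier D) ≤ 3 * ε}
              (fun z => ‖z‖ ^ (-((d : ℝ) + α - 1))) z)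
          ≤ C * ε * Metric.infDist x (frontier D) ^ (-α) := by
  have hα0 : 0 < α := one_pos.trans hα.1
  rcases (frontier D).eq_empty_or_nonempty with hE | hne
  · refine ⟨1, one_pos, fun s _ ε hε x _ hx => ?_⟩
    rw [hE, Metric.infDist_empty] at hx
    linarith [hε.1]
  obtain ⟨C, hC, hvol⟩ := volume_boundaryLayer_inter_ball_le hd hD hne
  have hq1 : (2 : ℝ) ^ (-α) < 1 := Real.rpow_lt_one_of_one_lt_of_neg one_lt_two (by linarith)
  have hq : 0 < (1 - (2 : ℝ) ^ (-α))⁻¹ := inv_pos.2 (by linarith)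
  refine ⟨C * 3 * 2 ^ (d - 1) * 4 ^ α * (1 - 2 ^ (-α))⁻¹, by positivity, ?_⟩
  intro s _ ε hε x _ hx
  have hε0 : 0 < ε := hε.1
  set ρ := Metric.infDist x (frontier D) with hρ
  have hρ0 : 0 < ρ := by linarith
  have hmeas : MeasurableSet (boundaryLayer D (3 * ε)) :=
    hD.1.measurableSet.inter
      (measurableSet_le (Metric.continuous_infDist_pt _).measurable measurable_const)
  have hmain := lintegral_indicator_norm_rpow_le hd hα0 (M := C * (3 * ε)) (a := ρ / 4)
    (by positivity) (by positivity) hmeas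
    (fun R hR => hvol (3 * ε) R x (by positivity) hR)
    (fun z hz => by
      have h1 : ρ ≤ Metric.infDist (x + z) (frontier D) + dist x (x + z) :=
        Metric.infDist_le_infDist_add_dist
      rw [dist_self_add_right] at h1
      linarith [hz.2])
  have hconst : C * (3 * ε) * 2 ^ (d - 1) * (ρ / 4) ^ (-α) * (1 - 2 ^ (-α))⁻¹
      = C * 3 * 2 ^ (d - 1) * 4 ^ α * (1 - 2 ^ (-α))⁻¹ * ε * ρ ^ (-α) := by
    rw [Real.div_rpow hρ0.le (by norm_num), Real.rpow_neg (by norm_num : (0 : ℝ) ≤ 4), div_inv_eq_mul]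
    ring
  rw [hconst] at hmain
  refine (Real.le_norm_self _).trans ((norm_integral_le_lintegral_norm _).trans ?_)
  refine ENNReal.toReal_le_of_le_ofReal (by positivity) (le_trans ?_ hmain)
  refine (setLIntegral_le_lintegral _ _).trans (lintegral_mono fun z => ?_)
  change ENNReal.ofReal ‖Set.indicator {z | x + z ∈ boundaryLayer D (3 * ε)}
    (fun z => ‖z‖ ^ (-((d : ℝ) + α - 1))) z‖ ≤ _
  by_cases hz : z ∈ {z | x + z ∈ boundaryLayer D (3 * ε)}
  · rw [Set.indicator_of_mem hz, Set.indicator_of_mem hz, Real.norm_of_nonneg (by positivity)]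
  · rw [Set.indicator_of_notMem hz]
    simp
end
end

section
/- Let D be a bounded Lipschitz domain in R^d and α ∈ (1,2). There exists a constant C > 0 such that for every s, ε ∈ (0,1) and every x ∈ D with dist(x,∂D) > 4ε, ∫_{|z|>sε} dist(x+z, ∂D)^{-2+α/2} · 1_{{x+z ∈ D, dist(x+z,∂D) > 3ε}} · |z|^{-(d+α-1)} dz ≤ C ( (sε)^{1-α} dist(x,∂D)^{-2+α/2} + ε^{-1+α/2} dist(x,∂D)^{-α} ). -/
noncomputable section
open MeasureTheory Metric Set Filter Topology

section TranslationEstimates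

variable {E : Type*} [NormedAddCommGroup E] [NormedSpace ℝ E] [FiniteDimensional ℝ E]
  [MeasurableSpace E] [BorelSpace E] (μ : Measure E) [μ.IsAddHaarMeasure]

/-- Tail bound for the kernel `‖z‖ ^ (-(dim + q))`. -/
lemma exists_setLIntegral_norm_rpow_le {q : ℝ} (hq : 0 < q) :
    ∃ K : ℝ, 0 < K ∧ ∀ a : ℝ, 0 < a →
      ∫⁻ z in {z : E | a ≤ ‖z‖}, ENNReal.ofReal (‖z‖ ^ (-((Module.finrank ℝ E : ℝ) + q))) ∂μ
        ≤ ENNReal.ofReal (K * a ^ (-q)) := by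
  set n := Module.finrank ℝ E with hn
  set p : ℝ := (n : ℝ) + q with hp
  have hp0 : 0 < p := by positivity
  set H : E → ENNReal := fun x => ENNReal.ofReal ((1 + ‖x‖) ^ (-p)) with hH
  have hfin : ∫⁻ x, H x ∂μ < ⊤ := finite_integral_one_add_norm (by linarith)
  have hHm : Measurable H := by fun_prop
  set J : ℝ := (∫⁻ x, H x ∂μ).toReal with hJ
  have hJ0 : 0 ≤ J := ENNReal.toReal_nonneg
  refine ⟨2 ^ p * (J + 1), by positivity, fun a ha => ?_⟩
  have hpt : ∀ z ∈ {z : E | a ≤ ‖z‖}, ENNReal.ofReal (‖z‖ ^ (-p)) ≤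
      ENNReal.ofReal (2 ^ p * a ^ (-p)) * H (a⁻¹ • z) := by
    intro z hz
    have hz : a ≤ ‖z‖ := hz
    have hz0 : 0 < ‖z‖ := ha.trans_le hz
    rw [hH, ← ENNReal.ofReal_mul (by positivity)]
    apply ENNReal.ofReal_le_ofReal
    have h1 : 1 + ‖a⁻¹ • z‖ ≤ 2 * (‖z‖ / a) := by
      rw [norm_smul, norm_inv, Real.norm_of_nonneg ha.le, inv_mul_eq_div]
      have : 1 ≤ ‖z‖ / a := by rwa [one_le_div ha]
      linarith
    have h2 : (2 * (‖z‖ / a)) ^ (-p) ≤ (1 + ‖a⁻¹ • z‖) ^ (-p) :=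
      Real.rpow_le_rpow_of_nonpos (by positivity) h1 (by linarith)
    calc ‖z‖ ^ (-p) = 2 ^ p * a ^ (-p) * (2 * (‖z‖ / a)) ^ (-p) := by
          rw [Real.mul_rpow (by positivity) (by positivity), Real.div_rpow hz0.le ha.le,
            Real.rpow_neg zero_le_two]
          field_simp
      _ ≤ _ := by gcongr
  calc _ ≤ ∫⁻ z in {z : E | a ≤ ‖z‖}, ENNReal.ofReal (2 ^ p * a ^ (-p)) * H (a⁻¹ • z) ∂μ :=
        setLIntegral_mono' (measurableSet_le measurable_const measurable_norm) hpt
    _ ≤ ∫⁻ z, ENNReal.ofReal (2 ^ p * a ^ (-p)) * H (a⁻¹ • z) ∂μ := setLIntegral_le_lintegral _ _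
    _ = ENNReal.ofReal (2 ^ p * a ^ (-p)) * ∫⁻ z, H (a⁻¹ • z) ∂μ :=
        lintegral_const_mul' _ _ ENNReal.ofReal_ne_top
    _ = ENNReal.ofReal (2 ^ p * a ^ (-p)) * (ENNReal.ofReal (a ^ n) * ENNReal.ofReal J) := by
        rw [← lintegral_map hHm (measurable_const_smul a⁻¹),
          Measure.map_addHaar_smul μ (inv_ne_zero ha.ne'), lintegral_smul_measure, smul_eq_mul,
          hJ, ENNReal.ofReal_toReal hfin.ne, ← hn, inv_pow, inv_inv, abs_of_pos (by positivity)]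
    _ = ENNReal.ofReal (2 ^ p * J * a ^ (-q)) := by
        rw [← ENNReal.ofReal_mul (by positivity), ← ENNReal.ofReal_mul (by positivity)]
        congr 1
        have : a ^ (-q) = a ^ (-p) * a ^ n := by
          rw [← Real.rpow_natCast, ← Real.rpow_add ha]
          congr 1
          rw [hp]; ring
        rw [this]; ring
    _ ≤ _ := by
        apply ENNReal.ofReal_le_ofReal
        gcongr
        linarith

/-- A set lying outside the ball of radius `b` which is disjoint from its translates by positive
multiples of a vector of length `τ` has small mass for the kernel `‖z‖ ^ (-(dim + q))`. -/
lemma exists_setLIntegral_norm_rpow_le_of_disjoint_translates {q : ℝ} (hq : 0 < q) :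
    ∃ K : ℝ, 0 < K ∧ ∀ b τ : ℝ, 0 < b → 0 < τ → ∀ v : E, ‖v‖ = 1 → ∀ S : Set E,
      MeasurableSet S → (∀ z ∈ S, b ≤ ‖z‖) →
      (∀ z ∈ S, ∀ m : ℕ, 1 ≤ m → z + ((m : ℝ) * τ) • v ∉ S) →
      ∫⁻ z in S, ENNReal.ofReal (‖z‖ ^ (-((Module.finrank ℝ E : ℝ) + q))) ∂μ
        ≤ ENNReal.ofReal (K * τ * b ^ (-(1 + q))) := by
  obtain ⟨K₀, hK₀, hK⟩ := exists_setLIntegral_norm_rpow_le μ hq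
  set p : ℝ := (Module.finrank ℝ E : ℝ) + q with hp
  have hp0 : 0 < p := by positivity
  refine ⟨2 ^ p * K₀ * 2 ^ q * 2, by positivity, fun b τ hb hτ v hv S hSm hSb hS => ?_⟩
  set k : E → ENNReal := fun z => ENNReal.ofReal (‖z‖ ^ (-p)) with hk
  set N : ℕ := ⌈b / (2 * τ)⌉₊ with hN
  let T : ℕ → Set E := fun i => {z | z - ((i : ℝ) * τ) • v ∈ S}
  have hTm : ∀ i, MeasurableSet (T i) := fun i =>
    (measurable_sub_const (((i : ℝ) * τ) • v)) hSm
  have hi : ∀ i ∈ Finset.range N, (i : ℝ) * τ ≤ b / 2 := by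
    intro i hi
    have h1 : (i : ℝ) < b / (2 * τ) := Nat.lt_ceil.1 (Finset.mem_range.1 hi)
    rw [lt_div_iff₀ (by positivity)] at h1
    linarith
  have hnv : ∀ i : ℕ, ‖((i : ℝ) * τ) • v‖ = i * τ := by
    intro i
    rw [norm_smul, hv, mul_one, Real.norm_of_nonneg (by positivity)]
  have hdisj : Set.PairwiseDisjoint (↑(Finset.range N)) T := by
    have key : ∀ i j : ℕ, i < j → Disjoint (T i) (T j) := by
      intro i j hij
      rw [Set.disjoint_left]
      intro z hzi hzj
      refine hS _ hzj (j - i) (by omega) ?_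
      have : z - ((j : ℝ) * τ) • v + (((j - i : ℕ) : ℝ) * τ) • v = z - ((i : ℝ) * τ) • v := by
        rw [Nat.cast_sub hij.le]; module
      rw [this]; exact hzi
    intro i _ j _ hij
    rcases lt_or_gt_of_ne hij with h | h
    · exact key i j h
    · exact (key j i h).symm
  have hTsub : (⋃ i ∈ Finset.range N, T i) ⊆ {z : E | b / 2 ≤ ‖z‖} := by
    intro z hz
    simp only [Set.mem_iUnion] at hz
    obtain ⟨i, hiN, hz⟩ := hz
    have h1 := hSb _ hz
    have h2 := norm_sub_le z (((i : ℝ) * τ) • v)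
    rw [hnv] at h2
    have h3 := hi i hiN
    show b / 2 ≤ ‖z‖
    linarith
  have htrans : ∀ i ∈ Finset.range N,
      ∫⁻ z in S, k z ∂μ ≤ ENNReal.ofReal (2 ^ p) * ∫⁻ z in T i, k z ∂μ := by
    intro i hiN
    have hmp : MeasurePreserving (fun z : E => z - ((i : ℝ) * τ) • v) μ μ :=
      measurePreserving_sub_right μ _
    have hemb : MeasurableEmbedding (fun z : E => z - ((i : ℝ) * τ) • v) :=
      (MeasurableEquiv.subRight (((i : ℝ) * τ) • v)).measurableEmbedding
    rw [← hmp.setLIntegral_comp_preimage_emb hemb, ← lintegral_const_mul' _ _ ENNReal.ofReal_ne_top]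
    refine setLIntegral_mono' (hTm i) fun z hz => ?_
    have hz1 : b ≤ ‖z - ((i : ℝ) * τ) • v‖ := hSb _ hz
    rw [hk, ← ENNReal.ofReal_mul (by positivity)]
    apply ENNReal.ofReal_le_ofReal
    have h3 := hi i hiN
    have h2 : b / 2 ≤ ‖z‖ := hTsub (by simp only [Set.mem_iUnion]; exact ⟨i, hiN, hz⟩)
    have h4 : ‖z‖ ≤ 2 * ‖z - ((i : ℝ) * τ) • v‖ := by
      have := norm_add_le (z - ((i : ℝ) * τ) • v) (((i : ℝ) * τ) • v)
      rw [sub_add_cancel, hnv] at this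
      linarith
    have h5 : (2 * ‖z - ((i : ℝ) * τ) • v‖) ^ (-p) ≤ ‖z‖ ^ (-p) :=
      Real.rpow_le_rpow_of_nonpos (by linarith) h4 (by linarith)
    calc _ = 2 ^ p * (2 * ‖z - ((i : ℝ) * τ) • v‖) ^ (-p) := by
          rw [Real.mul_rpow (by positivity) (by positivity), Real.rpow_neg zero_le_two]
          field_simp
      _ ≤ _ := by gcongr
  have hsum : ENNReal.ofReal (b / (2 * τ)) * ∫⁻ z in S, k z ∂μ
      ≤ ENNReal.ofReal (2 ^ p * (K₀ * (b / 2) ^ (-q))) := by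
    calc _ ≤ (N : ENNReal) * ∫⁻ z in S, k z ∂μ := by
          gcongr
          rw [← ENNReal.ofReal_natCast]
          exact ENNReal.ofReal_le_ofReal (Nat.le_ceil _)
      _ = ∑ i ∈ Finset.range N, ∫⁻ z in S, k z ∂μ := by simp
      _ ≤ ∑ i ∈ Finset.range N, ENNReal.ofReal (2 ^ p) * ∫⁻ z in T i, k z ∂μ :=
          Finset.sum_le_sum htrans
      _ = ENNReal.ofReal (2 ^ p) * ∫⁻ z in ⋃ i ∈ Finset.range N, T i, k z ∂μ := by
          rw [lintegral_biUnion_finset hdisj fun i _ => hTm i, Finset.mul_sum]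
      _ ≤ ENNReal.ofReal (2 ^ p) * ∫⁻ z in {z : E | b / 2 ≤ ‖z‖}, k z ∂μ := by
          gcongr
      _ ≤ ENNReal.ofReal (2 ^ p) * ENNReal.ofReal (K₀ * (b / 2) ^ (-q)) := by
          gcongr
          exact hK _ (by positivity)
      _ = _ := (ENNReal.ofReal_mul (by positivity)).symm
  have hc : 0 < b / (2 * τ) := by positivity
  rw [mul_comm, ← ENNReal.le_div_iff_mul_le (Or.inl (by simpa using hc))
    (Or.inl ENNReal.ofReal_ne_top), ← ENNReal.ofReal_div_of_pos hc] at hsum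
  refine hsum.trans (le_of_eq ?_)
  congr 1
  rw [Real.div_rpow hb.le zero_le_two, Real.rpow_neg zero_le_two, neg_add, Real.rpow_add hb,
    Real.rpow_neg_one]
  field_simp

end TranslationEstimates

/-- Near each boundary point, the distance to the boundary grows linearly along a fixed
direction. -/
lemma IsBoundedLipschitzDomain.exists_le_infDist {d : ℕ} {D : Set (EuclideanSpace ℝ (Fin d))}
    (hD : IsBoundedLipschitzDomain D) :
    ∃ ρ r : ℝ, 0 < ρ ∧ 0 < r ∧ ∀ p ∈ frontier D, ∃ v : EuclideanSpace ℝ (Fin d), ‖v‖ = 1 ∧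
      ∀ y ∈ D ∩ ball p ρ, ∀ m : ℝ, 0 < m → y + m • v ∈ ball p ρ →
        r * m ≤ infDist (y + m • v) (frontier D) := by
  obtain ⟨hDo, -, r, h, hr, hh, H⟩ := hD
  refine ⟨min r (h / 2), r, by positivity, hr, fun p hp => ?_⟩
  obtain ⟨v, hv, Hv⟩ := H p hp
  refine ⟨v, hv, fun y hy m hm hym => ?_⟩
  have h1 : dist y p < min r (h / 2) := hy.2
  have h2 : dist (y + m • v) p < min r (h / 2) := hym
  have hmh : m ≤ h := by
    have h3 : dist (y + m • v) y = m := by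
      rw [dist_self_add_left, norm_smul, hv, mul_one, Real.norm_of_nonneg hm.le]
    have h4 := dist_triangle_right (y + m • v) y p
    have h5 := min_le_right r (h / 2)
    linarith
  rw [le_infDist ⟨p, hp⟩]
  intro w hw
  by_contra! hlt
  have hwD : w ∈ D := Hv y ⟨h1.trans_le (min_le_left _ _), subset_closure hy.1⟩ m ⟨hm, hmh⟩ w
    (by rwa [mem_ball, dist_comm])
  rw [hDo.frontier_eq] at hw
  exact hw.2 hwD

section BoundaryPatch

variable {d : ℕ} {D : Set (EuclideanSpace ℝ (Fin d))}

lemma finrank_add_sub_one_eq (d : ℕ) (α : ℝ) :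
    -((d : ℝ) + α - 1) =
      -((Module.finrank ℝ (EuclideanSpace ℝ (Fin d)) : ℝ) + (α - 1)) := by
  rw [finrank_euclideanSpace_fin]; ring

/-- The weighted kernel over the part of a boundary patch lying at distance more than `ε` from
the boundary. -/
lemma exists_setLIntegral_boundary_patch_le (hDo : IsOpen D) {α β r : ℝ} (hα : 1 < α)
    (hβ : β < -1) (hr : 0 < r) :
    ∃ K : ℝ, 0 < K ∧ ∀ ε b : ℝ, 0 < ε → 0 < b → ∀ x v p : EuclideanSpace ℝ (Fin d), ∀ ρ : ℝ,
      ‖v‖ = 1 →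
      (∀ y ∈ D ∩ ball p ρ, ∀ m : ℝ, 0 < m → y + m • v ∈ ball p ρ →
        r * m ≤ infDist (y + m • v) (frontier D)) →
      ∫⁻ z in {z | x + z ∈ D ∩ ball p ρ ∧ ε < infDist (x + z) (frontier D) ∧ b ≤ ‖z‖},
          ENNReal.ofReal (infDist (x + z) (frontier D) ^ β) *
            ENNReal.ofReal (‖z‖ ^ (-((d : ℝ) + α - 1)))
        ≤ ENNReal.ofReal (K * (ε ^ (1 + β) * b ^ (-α))) := by
  obtain ⟨K, hK0, hK⟩ := exists_setLIntegral_norm_rpow_le_of_disjoint_translates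
    (volume : Measure (EuclideanSpace ℝ (Fin d))) (sub_pos.2 hα)
  simp only [← finrank_add_sub_one_eq] at hK
  set θ : ℝ := 2 ^ (1 + β) with hθ
  have hθ0 : 0 < θ := by positivity
  have hθ1 : θ < 1 := Real.rpow_lt_one_of_one_lt_of_neg one_lt_two (by linarith)
  refine ⟨K * (4 / r) * (1 - θ)⁻¹, by have := sub_pos.2 hθ1; positivity, ?_⟩
  intro ε b hε hb x v p ρ hv hcone
  set δ : EuclideanSpace ℝ (Fin d) → ℝ := fun z => infDist (x + z) (frontier D) with hδ
  have hδm : Measurable δ := by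
    have : Continuous δ := (continuous_infDist_pt _).comp (continuous_const.add continuous_id)
    exact this.measurable
  set k : EuclideanSpace ℝ (Fin d) → ENNReal :=
    fun z => ENNReal.ofReal (‖z‖ ^ (-((d : ℝ) + α - 1))) with hk
  let S : ℕ → Set (EuclideanSpace ℝ (Fin d)) := fun j =>
    {z | x + z ∈ D ∩ ball p ρ ∧ (2 ^ j * ε ≤ δ z ∧ δ z ≤ 2 ^ (j + 1) * ε) ∧ b ≤ ‖z‖}
  have hSm : ∀ j, MeasurableSet (S j) := by
    intro j
    refine MeasurableSet.inter ?_ (MeasurableSet.inter (MeasurableSet.inter ?_ ?_) ?_)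
    · exact (measurable_const_add x) (hDo.inter isOpen_ball).measurableSet
    · exact measurableSet_le measurable_const hδm
    · exact measurableSet_le hδm measurable_const
    · exact measurableSet_le measurable_const measurable_norm
  have hcover : {z | x + z ∈ D ∩ ball p ρ ∧ ε < δ z ∧ b ≤ ‖z‖} ⊆ ⋃ j, S j := by
    rintro z ⟨h1, h2, h3⟩
    obtain ⟨j, hj1, hj2⟩ := exists_nat_pow_near (x := δ z / ε) (y := 2)
      (by rw [one_le_div hε]; exact h2.le) one_lt_two
    rw [le_div_iff₀ hε] at hj1
    rw [div_lt_iff₀ hε] at hj2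
    exact Set.mem_iUnion.2 ⟨j, h1, ⟨hj1, hj2.le⟩, h3⟩
  have hlayer : ∀ j, ∫⁻ z in S j, ENNReal.ofReal (δ z ^ β) * k z
      ≤ ENNReal.ofReal (K * (4 / r) * (ε ^ (1 + β) * b ^ (-α)) * θ ^ j) := by
    intro j
    have ht : (0 : ℝ) < 2 ^ j * ε := by positivity
    have hτ : 0 < 2 * (2 ^ (j + 1) * ε) / r := by positivity
    have hk1 : ∫⁻ z in S j, k z ≤
        ENNReal.ofReal (K * (2 * (2 ^ (j + 1) * ε) / r) * b ^ (-(1 + (α - 1)))) := by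
      refine hK b _ hb hτ v hv (S j) (hSm j) (fun z hz => hz.2.2) ?_
      intro z hz m hm hzm
      have hm' : (1 : ℝ) ≤ m := by exact_mod_cast hm
      have h1 := hcone (x + z) hz.1 (m * (2 * (2 ^ (j + 1) * ε) / r)) (by positivity)
        (by rw [add_assoc]; exact hzm.1.2)
      rw [add_assoc] at h1
      have h2 := hzm.2.1.2
      have h3 : r * (m * (2 * (2 ^ (j + 1) * ε) / r)) = m * (2 * (2 ^ (j + 1) * ε)) := by
        field_simp
      have h4 : 1 * (2 * (2 ^ (j + 1) * ε)) ≤ m * (2 * (2 ^ (j + 1) * ε)) := by gcongr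
      have h5 : 0 < 2 ^ (j + 1) * ε := by positivity
      simp only [hδ] at h2
      linarith
    calc _ ≤ ∫⁻ z in S j, ENNReal.ofReal ((2 ^ j * ε) ^ β) * k z := by
          refine setLIntegral_mono' (hSm j) fun z hz => ?_
          exact mul_le_mul_left (ENNReal.ofReal_le_ofReal
            (Real.rpow_le_rpow_of_nonpos ht hz.2.1.1 (by linarith))) _
      _ = ENNReal.ofReal ((2 ^ j * ε) ^ β) * ∫⁻ z in S j, k z :=
          lintegral_const_mul' _ _ ENNReal.ofReal_ne_top
      _ ≤ _ := mul_le_mul_right hk1 _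
      _ = _ := by
          rw [← ENNReal.ofReal_mul (by positivity)]
          congr 1
          have e1 : (2 ^ j * ε) ^ β * (2 ^ j * ε) = ε ^ (1 + β) * θ ^ j := by
            rw [← Real.rpow_add_one ht.ne', Real.mul_rpow (by positivity) hε.le, hθ,
              add_comm β 1, ← Real.rpow_natCast, ← Real.rpow_natCast, ← Real.rpow_mul zero_le_two,
              ← Real.rpow_mul zero_le_two, mul_comm (j : ℝ), mul_comm]
          have e2 : -(1 + (α - 1)) = -α := by ring
          rw [e2, pow_succ]
          linear_combination (K * (4 / r) * b ^ (-α)) * e1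
  calc _ ≤ ∫⁻ z in ⋃ j, S j, ENNReal.ofReal (δ z ^ β) * k z := lintegral_mono_set hcover
    _ ≤ ∑' j, ∫⁻ z in S j, ENNReal.ofReal (δ z ^ β) * k z := lintegral_iUnion_le _ _
    _ ≤ ∑' j, ENNReal.ofReal (K * (4 / r) * (ε ^ (1 + β) * b ^ (-α)) * θ ^ j) :=
        ENNReal.tsum_le_tsum hlayer
    _ = _ := by
        rw [← ENNReal.ofReal_tsum_of_nonneg (fun j => by positivity)
          ((summable_geometric_of_lt_one hθ0.le hθ1).mul_left _), tsum_mul_left,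
          tsum_geometric_of_lt_one hθ0.le hθ1]
        congr 1
        ring

end BoundaryPatch

theorem stmt_1 {d : ℕ} (hd : 0 < d) {D : Set (EuclideanSpace ℝ (Fin d))}
    (hD : IsBoundedLipschitzDomain D) {α : ℝ} (hα : α ∈ Set.Ioo (1 : ℝ) 2) :
    ∃ C : ℝ, 0 < C ∧
      ∀ s ∈ Set.Ioo (0 : ℝ) 1, ∀ ε ∈ Set.Ioo (0 : ℝ) 1, ∀ x ∈ D,
        4 * ε < Metric.infDist x (frontier D) →
        (∫ z in {z : EuclideanSpace ℝ (Fin d) | s * ε < ‖z‖},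
            Set.indicator {z : EuclideanSpace ℝ (Fin d) |
                x + z ∈ D ∧ 3 * ε < Metric.infDist (x + z) (frontier D)}
              (fun z =>
                Metric.infDist (x + z) (frontier D) ^ (-2 + α / 2) *
                  ‖z‖ ^ (-((d : ℝ) + α - 1))) z)
          ≤ C * ((s * ε) ^ (1 - α) * Metric.infDist x (frontier D) ^ (-2 + α / 2)
              + ε ^ (-1 + α / 2) * Metric.infDist x (frontier D) ^ (-α)) := by
  obtain ⟨hα1, hα2⟩ := hα
  have hDo : IsOpen D := hD.1
  have hDb : Bornology.IsBounded D := hD.2.1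
  obtain ⟨ρ, r, hρ, hr, hcone⟩ := hD.exists_le_infDist
  obtain ⟨K₁, hK₁, hpatch⟩ := exists_setLIntegral_boundary_patch_le hDo hα1
    (show -2 + α / 2 < -1 by linarith) hr
  obtain ⟨K₀, hK₀, htail⟩ := exists_setLIntegral_norm_rpow_le
    (volume : Measure (EuclideanSpace ℝ (Fin d))) (sub_pos.2 hα1)
  simp only [← finrank_add_sub_one_eq] at htail
  choose! v hv1 hv using hcone
  have hFc : IsCompact (frontier D) :=
    hDb.isCompact_closure.of_isClosed_subset isClosed_frontier frontier_subset_closure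
  obtain ⟨t, htF, htfin, htcov⟩ := hFc.finite_cover_balls (half_pos hρ)
  lift t to Finset (EuclideanSpace ℝ (Fin d)) using htfin
  set M : ℝ := diam (closure D) with hM
  have hM0 : 0 ≤ M := diam_nonneg
  set β : ℝ := -2 + α / 2 with hβ
  have hβ0 : β < 0 := by linarith
  set C₁ : ℝ := 2 ^ (-β) * K₀ with hC₁
  set C₂ : ℝ := t.card * (K₁ * 2 ^ α) with hC₂
  set C₃ : ℝ := (ρ / 2) ^ β * K₀ * 2 ^ (α - 1) * M with hC₃
  have hC₁0 : 0 < C₁ := by positivity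
  have hC₂0 : 0 ≤ C₂ := by positivity
  have hC₃0 : 0 ≤ C₃ := by positivity
  refine ⟨C₁ + C₂ + C₃, by positivity, ?_⟩
  rintro s ⟨hs, -⟩ ε ⟨hε, hε1⟩ x hx hxε
  set F := frontier D with hF
  set δ : ℝ := infDist x F with hδ
  have hδ0 : 0 < δ := by linarith
  have hFne : F.Nonempty := by
    by_contra h
    rw [Set.not_nonempty_iff_eq_empty] at h
    rw [hδ, h, infDist_empty] at hδ0
    exact hδ0.false
  have hδM : δ ≤ M := by
    obtain ⟨p, hp⟩ := hFne
    exact (infDist_le_dist_of_mem hp).trans (dist_le_diam_of_mem hDb.closure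
      (subset_closure hx) (frontier_subset_closure hp))
  set k : EuclideanSpace ℝ (Fin d) → ENNReal :=
    fun z => ENNReal.ofReal (‖z‖ ^ (-((d : ℝ) + α - 1))) with hk
  set G : EuclideanSpace ℝ (Fin d) → ENNReal :=
    fun z => ENNReal.ofReal (infDist (x + z) F ^ β) * k z with hG
  have hδm : Measurable fun z => infDist (x + z) F := by
    have : Continuous fun z => infDist (x + z) F :=
      (continuous_infDist_pt _).comp (continuous_const.add continuous_id)
    exact this.measurable
  have hbound : ∀ a c : ℝ, 0 < a → 0 < c →
      ∫⁻ z in {z | a ≤ infDist (x + z) F ∧ c ≤ ‖z‖}, G z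
        ≤ ENNReal.ofReal (a ^ β * (K₀ * c ^ (1 - α))) := by
    intro a c ha hc
    calc _ ≤ ∫⁻ z in {z | a ≤ infDist (x + z) F ∧ c ≤ ‖z‖}, ENNReal.ofReal (a ^ β) * k z := by
          refine setLIntegral_mono' ((measurableSet_le measurable_const hδm).inter
            (measurableSet_le measurable_const measurable_norm)) fun z hz => ?_
          exact mul_le_mul_left (ENNReal.ofReal_le_ofReal
            (Real.rpow_le_rpow_of_nonpos ha hz.1 hβ0.le)) _
      _ ≤ ∫⁻ z in {z | c ≤ ‖z‖}, ENNReal.ofReal (a ^ β) * k z :=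
          lintegral_mono_set fun z hz => hz.2
      _ = ENNReal.ofReal (a ^ β) * ∫⁻ z in {z | c ≤ ‖z‖}, k z :=
          lintegral_const_mul' _ _ ENNReal.ofReal_ne_top
      _ ≤ ENNReal.ofReal (a ^ β) * ENNReal.ofReal (K₀ * c ^ (-(α - 1))) :=
          mul_le_mul_right (htail c hc) _
      _ = _ := by rw [← ENNReal.ofReal_mul (by positivity), neg_sub]
  let A : Set (EuclideanSpace ℝ (Fin d)) := {z | δ / 2 ≤ infDist (x + z) F ∧ s * ε ≤ ‖z‖}
  let P : EuclideanSpace ℝ (Fin d) → Set (EuclideanSpace ℝ (Fin d)) := fun p =>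
    {z | x + z ∈ D ∩ ball p ρ ∧ ε < infDist (x + z) F ∧ δ / 2 ≤ ‖z‖}
  let B : Set (EuclideanSpace ℝ (Fin d)) := {z | ρ / 2 ≤ infDist (x + z) F ∧ δ / 2 ≤ ‖z‖}
  have hcover : {z : EuclideanSpace ℝ (Fin d) | s * ε < ‖z‖} ∩
      {z | x + z ∈ D ∧ 3 * ε < infDist (x + z) F} ⊆ A ∪ ((⋃ p : t, P p) ∪ B) := by
    rintro z ⟨hz1, hz2, hz3⟩
    by_cases h1 : δ / 2 ≤ infDist (x + z) F
    · exact Or.inl ⟨h1, le_of_lt hz1⟩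
    right
    have hz : δ / 2 ≤ ‖z‖ := by
      have := infDist_le_infDist_add_dist (s := F) (x := x) (y := x + z)
      rw [dist_self_add_right] at this
      linarith
    by_cases h2 : ρ / 2 ≤ infDist (x + z) F
    · exact Or.inr ⟨h2, hz⟩
    left
    obtain ⟨q, hq, hqd⟩ := (infDist_lt_iff hFne).1 (not_le.1 h2)
    obtain ⟨p, hp, hpq⟩ := Set.mem_iUnion₂.1 (htcov hq)
    refine Set.mem_iUnion.2 ⟨⟨p, hp⟩, ⟨hz2, ?_⟩, by linarith, hz⟩
    have := dist_triangle (x + z) q p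
    rw [mem_ball] at hpq ⊢
    linarith
  have hβ1 : -1 + α / 2 = 1 + β := by rw [hβ]; ring
  have hA : ∫⁻ z in A, G z ≤ ENNReal.ofReal (C₁ * ((s * ε) ^ (1 - α) * δ ^ β)) := by
    refine (hbound _ _ (half_pos hδ0) (by positivity)).trans (le_of_eq ?_)
    congr 1
    rw [hC₁, Real.div_rpow hδ0.le zero_le_two, Real.rpow_neg zero_le_two]
    field_simp
  have hP : ∫⁻ z in ⋃ p : t, P p, G z ≤ ENNReal.ofReal (C₂ * (ε ^ (1 + β) * δ ^ (-α))) := by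
    calc _ ≤ ∑' p : t, ∫⁻ z in P p, G z := lintegral_iUnion_le _ _
      _ ≤ ∑' _ : t, ENNReal.ofReal (K₁ * (ε ^ (1 + β) * (δ / 2) ^ (-α))) :=
          ENNReal.tsum_le_tsum fun p => hpatch ε _ hε (half_pos hδ0) x (v p) p ρ
            (hv1 p (htF p.2)) (hv p (htF p.2))
      _ = _ := by
          rw [tsum_fintype, Finset.sum_const, Finset.card_univ, Fintype.card_coe, nsmul_eq_mul,
            ← ENNReal.ofReal_natCast, ← ENNReal.ofReal_mul (by positivity)]
          congr 1
          rw [hC₂, Real.div_rpow hδ0.le zero_le_two, Real.rpow_neg zero_le_two]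
          field_simp
  have hB : ∫⁻ z in B, G z ≤ ENNReal.ofReal (C₃ * (ε ^ (1 + β) * δ ^ (-α))) := by
    refine (hbound _ _ (half_pos hρ) (half_pos hδ0)).trans (ENNReal.ofReal_le_ofReal ?_)
    have hε' : 1 ≤ ε ^ (1 + β) :=
      Real.one_le_rpow_of_pos_of_le_one_of_nonpos hε hε1.le (by rw [hβ]; linarith)
    have e : (δ / 2) ^ (1 - α) = 2 ^ (α - 1) * (δ * δ ^ (-α)) := by
      rw [Real.div_rpow hδ0.le zero_le_two, ← neg_sub α 1, Real.rpow_neg zero_le_two, neg_sub,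
        sub_eq_add_neg, Real.rpow_add hδ0, Real.rpow_one]
      field_simp
    calc _ = (ρ / 2) ^ β * K₀ * 2 ^ (α - 1) * δ * (1 * δ ^ (-α)) := by rw [e]; ring
      _ ≤ _ := by rw [hC₃]; gcongr
  have hfinal : ∫⁻ z in {z : EuclideanSpace ℝ (Fin d) | s * ε < ‖z‖},
      Set.indicator {z | x + z ∈ D ∧ 3 * ε < infDist (x + z) F} G z
        ≤ ENNReal.ofReal ((C₁ + C₂ + C₃) * ((s * ε) ^ (1 - α) * δ ^ β
          + ε ^ (1 + β) * δ ^ (-α))) := by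
    calc _ = ∫⁻ z in {z : EuclideanSpace ℝ (Fin d) | s * ε < ‖z‖} ∩
          {z | x + z ∈ D ∧ 3 * ε < infDist (x + z) F}, G z := by
          rw [setLIntegral_indicator, Set.inter_comm]
          exact ((measurable_const_add x) hDo.measurableSet).inter
            (measurableSet_lt measurable_const hδm)
      _ ≤ ∫⁻ z in A ∪ ((⋃ p : t, P p) ∪ B), G z := lintegral_mono_set hcover
      _ ≤ (∫⁻ z in A, G z) + ((∫⁻ z in ⋃ p : t, P p, G z) + ∫⁻ z in B, G z) :=
          (lintegral_union_le _ _ _).trans (add_le_add le_rfl (lintegral_union_le _ _ _))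
      _ ≤ ENNReal.ofReal (C₁ * ((s * ε) ^ (1 - α) * δ ^ β)) +
          (ENNReal.ofReal (C₂ * (ε ^ (1 + β) * δ ^ (-α))) +
            ENNReal.ofReal (C₃ * (ε ^ (1 + β) * δ ^ (-α)))) :=
          add_le_add hA (add_le_add hP hB)
      _ ≤ _ := by
          rw [← ENNReal.ofReal_add (by positivity) (by positivity),
            ← ENNReal.ofReal_add (by positivity) (by positivity)]
          apply ENNReal.ofReal_le_ofReal
          have h1 : 0 ≤ (s * ε) ^ (1 - α) * δ ^ β := by positivity
          have h2 : 0 ≤ ε ^ (1 + β) * δ ^ (-α) := by positivity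
          nlinarith [mul_nonneg hC₂0 h1, mul_nonneg hC₃0 h1, mul_nonneg hC₁0.le h2]
  rw [hβ1]
  refine (Real.le_norm_self _).trans ((norm_integral_le_lintegral_norm _).trans
    (ENNReal.toReal_le_of_le_ofReal (by positivity) (le_trans (le_of_eq ?_) hfinal)))
  congr 1 with z
  by_cases hz : z ∈ {z | x + z ∈ D ∧ 3 * ε < infDist (x + z) F}
  · rw [Set.indicator_of_mem hz, Set.indicator_of_mem hz, hG, hk,
      Real.norm_of_nonneg (mul_nonneg (Real.rpow_nonneg infDist_nonneg _) (by positivity)),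
      ENNReal.ofReal_mul (Real.rpow_nonneg infDist_nonneg _)]
  · rw [Set.indicator_of_notMem hz, Set.indicator_of_notMem hz, norm_zero, ENNReal.ofReal_zero]
end
end

section
/- Let D be a bounded Lipschitz domain in R^d, α ∈ (0,1), and β ∈ (α/2, α). There exists a constant C > 0 such that for all ε ∈ (0,1) and all x ∈ D with dist(x,∂D) > 4ε, ∫_{|z|>ε} dist(x+z,∂D)^{-1-β+α/2} 1_{{x+z ∈ D, dist(x+z,∂D) > 3ε}} |z|^{-(d+α-β)} dz ≤ C ( ε^{-(β-α/2)} dist(x,∂D)^{-1-(α-β)} + ε^{-(α-β)} dist(x,∂D)^{-1-β+α/2} ). -/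
noncomputable section
open MeasureTheory Metric Set Filter Topology

open scoped ENNReal

/-- If `μ {f < t} ≤ K t ^ m` for all `t > 0` and `f ≥ c > 0`, then `∫ f ^ (-q) dμ` is at most
`K q / (q - m) c ^ (m - q)` whenever `q > m`. -/
theorem lintegral_rpow_neg_le {Ω : Type*} [MeasurableSpace Ω] {μ : Measure Ω} {f : Ω → ℝ}
    (hf : Measurable f) {c q m : ℝ} {K : ℝ≥0∞} (hc : 0 < c) (hq : 0 < q) (hmq : m < q)
    (hcf : ∀ᵐ ω ∂μ, c ≤ f ω)
    (hK : ∀ t : ℝ, 0 < t → μ {ω | f ω < t} ≤ K * ENNReal.ofReal (t ^ m)) :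
    ∫⁻ ω, ENNReal.ofReal (f ω ^ (-q)) ∂μ
      ≤ K * ENNReal.ofReal (q / (q - m) * c ^ (m - q)) := by
  have hinv : ∫⁻ ω, ENNReal.ofReal (f ω ^ (-q)) ∂μ
      = ∫⁻ ω, ENNReal.ofReal ((f ω)⁻¹ ^ q) ∂μ := by
    refine lintegral_congr_ae ?_
    filter_upwards [hcf] with ω hω
    rw [Real.rpow_neg (hc.le.trans hω), Real.inv_rpow (hc.le.trans hω)]
  have hnn : 0 ≤ᵐ[μ] fun ω => (f ω)⁻¹ := by
    filter_upwards [hcf] with ω hω using inv_nonneg.2 (hc.le.trans hω)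
  have htail : ∀ t ∈ Ioi (0 : ℝ),
      μ {ω | t < (f ω)⁻¹} * ENNReal.ofReal (t ^ (q - 1))
        ≤ (Ioc 0 c⁻¹).indicator (fun t => K * ENNReal.ofReal (t ^ (q - 1 - m))) t := by
    intro t ht
    have ht : 0 < t := ht
    by_cases htc : t ≤ c⁻¹
    · rw [indicator_of_mem (show t ∈ Ioc 0 c⁻¹ from ⟨ht, htc⟩)]
      have hle : μ {ω | t < (f ω)⁻¹} ≤ μ {ω | f ω < t⁻¹} := by
        refine measure_mono_ae ?_
        filter_upwards [hcf] with ω hω h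
        exact (lt_inv_comm₀ ht (hc.trans_le hω)).1 h
      calc _ ≤ K * ENNReal.ofReal (t⁻¹ ^ m) * ENNReal.ofReal (t ^ (q - 1)) := by
            gcongr
            exact hle.trans (hK _ (inv_pos.2 ht))
        _ = _ := by
            rw [mul_assoc, ← ENNReal.ofReal_mul (by positivity), Real.inv_rpow ht.le,
              ← Real.rpow_neg ht.le, ← Real.rpow_add ht]
            ring_nf
    · have : μ {ω | t < (f ω)⁻¹} = 0 := by
        refine measure_mono_null (t := {ω | ¬ c ≤ f ω}) (fun ω h hω => htc ?_) hcf
        exact (show t < (f ω)⁻¹ from h).le.trans (inv_anti₀ hc hω)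
      simp [this]
  have hint : ∫⁻ t in Ioc 0 c⁻¹, ENNReal.ofReal (t ^ (q - 1 - m))
      = ENNReal.ofReal (c ^ (m - q) / (q - m)) := by
    have h1 : -1 < q - 1 - m := by linarith
    rw [← ofReal_integral_eq_lintegral_ofReal, ← intervalIntegral.integral_of_le (by positivity),
      integral_rpow (Or.inl h1), Real.zero_rpow (by linarith), sub_zero,
      Real.inv_rpow hc.le, ← Real.rpow_neg hc.le]
    · ring_nf
    · exact (intervalIntegrable_iff_integrableOn_Ioc_of_le (by positivity)).1
        (intervalIntegral.intervalIntegrable_rpow' h1)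
    · exact ae_restrict_of_forall_mem measurableSet_Ioc fun t ht => Real.rpow_nonneg ht.1.le _
  rw [hinv, lintegral_rpow_eq_lintegral_meas_lt_mul μ hnn hf.inv.aemeasurable hq]
  calc _ ≤ ENNReal.ofReal q * ∫⁻ t in Ioi (0 : ℝ),
        (Ioc 0 c⁻¹).indicator (fun t => K * ENNReal.ofReal (t ^ (q - 1 - m))) t := by
        refine mul_le_mul' le_rfl ?_
        exact setLIntegral_mono' measurableSet_Ioi htail
    _ ≤ ENNReal.ofReal q * ∫⁻ t in Ioc 0 c⁻¹, K * ENNReal.ofReal (t ^ (q - 1 - m)) := by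
        refine mul_le_mul' le_rfl ?_
        rw [← lintegral_indicator measurableSet_Ioc]
        exact setLIntegral_le_lintegral _ _
    _ = _ := by
        rw [lintegral_const_mul _ (by fun_prop), hint, mul_left_comm,
          ← ENNReal.ofReal_mul hq.le]
        ring_nf

/-- If the translates of `S` by `0, w, …, N w` are disjoint and contained in `B`, then
`(N + 1) |S| ≤ |B|`. -/
theorem card_mul_volume_le_of_disjoint_translates {E : Type*} [AddCommGroup E]
    [MeasurableSpace E] [MeasurableAdd E] (μ : Measure E) [μ.IsAddLeftInvariant] {S B : Set E}
    (hS : MeasurableSet S) (w : E) (N : ℕ)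
    (hdisj : ∀ k : ℕ, 0 < k → k ≤ N → ∀ z ∈ S, z + k • w ∉ S)
    (hB : ∀ k ≤ N, ∀ z ∈ S, z + k • w ∈ B) :
    ((N + 1 : ℕ) : ℝ≥0∞) * μ S ≤ μ B := by
  let T : ℕ → Set E := fun k => (fun z => -(k • w) + z) ⁻¹' S
  have hT : ∀ k, MeasurableSet (T k) := fun k => measurable_const_add _ hS
  have key : ∀ i j, i < j → j ≤ N → Disjoint (T i) (T j) := by
    intro i j hij hj
    refine Set.disjoint_left.2 fun z hzi hzj => ?_
    refine hdisj (j - i) (by omega) (by omega) _ hzj ?_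
    have : -(j • w) + z + (j - i) • w = -(i • w) + z := by
      rw [← Nat.sub_add_cancel hij.le, add_nsmul]
      simp only [Nat.add_sub_cancel]
      abel
    rw [this]
    exact hzi
  have hpair : (↑(Finset.range (N + 1)) : Set ℕ).PairwiseDisjoint T := by
    intro i hi j hj hij
    simp only [Finset.coe_range, mem_Iio] at hi hj
    rcases lt_or_gt_of_ne hij with h | h
    · exact key i j h (by omega)
    · exact (key j i h (by omega)).symm
  calc ((N + 1 : ℕ) : ℝ≥0∞) * μ S = ∑ k ∈ Finset.range (N + 1), μ (T k) := by
        simp [T, measure_preimage_add]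
    _ = μ (⋃ k ∈ Finset.range (N + 1), T k) :=
        (measure_biUnion_finset hpair fun k _ => hT k).symm
    _ ≤ μ B := by
        refine measure_mono (iUnion₂_subset fun k hk z hz => ?_)
        have := hB k (by simpa [Nat.lt_succ_iff] using hk) _ hz
        simpa using this

/-- In a cone chart, a boundary collar of width `t` occupies at most a volume of order
`t ρ ^ (d - 1)` in a ball of radius `ρ`. -/
theorem volume_collar_inter_chart_le {d : ℕ} {D : Set (EuclideanSpace ℝ (Fin d))}
    (hDo : IsOpen D) (hne : (frontier D).Nonempty) {p v : EuclideanSpace ℝ (Fin d)}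
    {r h M : ℝ} (hr : 0 < r) (hh : 0 < h) (hv : ‖v‖ = 1)
    (hcone : ∀ x ∈ ball p r ∩ closure D, ∀ t ∈ Ioc (0 : ℝ) h,
      ∀ y ∈ ball (x + t • v) (r * t), y ∈ D)
    (x : EuclideanSpace ℝ (Fin d)) {ρ t : ℝ} (hρ : 0 < ρ) (hρM : ρ ≤ M) (ht : 0 < t) :
    volume {z | (x + z ∈ D ∧ x + z ∈ ball p r) ∧ ‖z‖ < ρ ∧ infDist (x + z) (frontier D) < t}
      ≤ volume (ball (0 : EuclideanSpace ℝ (Fin d)) 1)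
        * ENNReal.ofReal (2 ^ d / (r * min 1 (h / M)) * (t * ρ ^ ((d : ℝ) - 1))) := by
  set S := {z | (x + z ∈ D ∧ x + z ∈ ball p r) ∧ ‖z‖ < ρ ∧ infDist (x + z) (frontier D) < t}
  have hS : MeasurableSet S := by
    have hadd : Continuous fun z : EuclideanSpace ℝ (Fin d) => x + z := by fun_prop
    have hδ : Continuous fun z => infDist (x + z) (frontier D) :=
      (continuous_infDist_pt _).comp hadd
    have hDm : MeasurableSet {z | x + z ∈ D} := (hDo.preimage hadd).measurableSet
    have hpm : MeasurableSet {z | x + z ∈ ball p r} := (isOpen_ball.preimage hadd).measurableSet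
    exact (hDm.inter hpm).inter ((measurableSet_lt measurable_norm measurable_const).inter
      (measurableSet_lt hδ.measurable measurable_const))
  have hM : 0 < M := hρ.trans_le hρM
  set τ := t / r with hτdef
  have hτ : 0 < τ := div_pos ht hr
  set ℓ := min ρ h with hℓdef
  have hℓ : 0 < ℓ := lt_min hρ hh
  set N := ⌊ℓ / τ⌋₊
  have hNτ : ∀ k : ℕ, k ≤ N → (k : ℝ) * τ ≤ ℓ := fun k hk =>
    (le_div_iff₀ hτ).1 ((Nat.cast_le.2 hk).trans (Nat.floor_le (by positivity)))
  have hsmul : ∀ k : ℕ, k • (τ • v) = ((k : ℝ) * τ) • v := fun k => by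
    rw [← Nat.cast_smul_eq_nsmul ℝ, smul_smul]
  have hpack : ((N + 1 : ℕ) : ℝ≥0∞) * volume S ≤
      volume (ball (0 : EuclideanSpace ℝ (Fin d)) (2 * ρ)) := by
    refine card_mul_volume_le_of_disjoint_translates volume hS (τ • v) N ?_ ?_
    · rintro k hk hkN z ⟨⟨hzD, hzp⟩, -, -⟩ ⟨-, -, hz⟩
      refine hz.not_ge ?_
      have hk1 : (1 : ℝ) ≤ k := by exact_mod_cast hk
      have htk : t ≤ r * (k * τ) := by
        have : r * (k * τ) = k * t := by rw [hτdef]; field_simp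
        rw [this]
        exact le_mul_of_one_le_left ht.le hk1
      refine htk.trans ((le_infDist hne).2 fun y hy => ?_)
      by_contra! hlt
      have hyD : y ∈ D := by
        refine hcone (x + z) ⟨hzp, subset_closure hzD⟩ (k * τ)
          ⟨by positivity, (hNτ k hkN).trans (min_le_right _ _)⟩ y ?_
        rw [mem_ball, dist_comm, ← hsmul, add_assoc]
        exact hlt
      rw [hDo.frontier_eq] at hy
      exact hy.2 hyD
    · rintro k hkN z ⟨-, hz, -⟩
      rw [mem_ball_zero_iff, hsmul]
      calc ‖z + ((k : ℝ) * τ) • v‖ ≤ ‖z‖ + ‖((k : ℝ) * τ) • v‖ := norm_add_le _ _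
        _ = ‖z‖ + k * τ := by
          rw [norm_smul, hv, mul_one, Real.norm_of_nonneg (by positivity)]
        _ < 2 * ρ := by linarith [(hNτ k hkN).trans (min_le_left ρ h)]
  have hκ : 0 < min 1 (h / M) := lt_min one_pos (div_pos hh hM)
  have hκℓ : ρ * min 1 (h / M) ≤ ℓ := by
    refine le_min (mul_le_of_le_one_right hρ.le (min_le_left _ _)) ?_
    calc ρ * min 1 (h / M) ≤ M * (h / M) := by
          gcongr
          exact min_le_right _ _
      _ = h := by field_simp
  have hfloor : ENNReal.ofReal (ℓ / τ) ≤ ((N + 1 : ℕ) : ℝ≥0∞) := by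
    rw [← ENNReal.ofReal_natCast]
    refine ENNReal.ofReal_le_ofReal ?_
    push_cast
    exact (Nat.lt_floor_add_one _).le
  have hreal : τ / ℓ * (2 * ρ) ^ d ≤ 2 ^ d / (r * min 1 (h / M)) * (t * ρ ^ ((d : ℝ) - 1)) := by
    calc τ / ℓ * (2 * ρ) ^ d ≤ τ / (ρ * min 1 (h / M)) * (2 * ρ) ^ d := by gcongr
      _ = _ := by
        rw [Real.rpow_sub_one hρ.ne', Real.rpow_natCast, mul_pow, hτdef]
        field_simp
  calc volume S = ENNReal.ofReal (τ / ℓ) * (ENNReal.ofReal (ℓ / τ) * volume S) := by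
        rw [← mul_assoc, ← ENNReal.ofReal_mul (by positivity),
          show τ / ℓ * (ℓ / τ) = 1 by field_simp, ENNReal.ofReal_one, one_mul]
    _ ≤ ENNReal.ofReal (τ / ℓ) * volume (ball (0 : EuclideanSpace ℝ (Fin d)) (2 * ρ)) := by
        gcongr
        exact (mul_le_mul' hfloor le_rfl).trans hpack
    _ = volume (ball (0 : EuclideanSpace ℝ (Fin d)) 1)
          * ENNReal.ofReal (τ / ℓ * (2 * ρ) ^ d) := by
        rw [Measure.addHaar_ball_of_pos volume 0 (by positivity : 0 < 2 * ρ),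
          finrank_euclideanSpace_fin, ← mul_assoc, ← ENNReal.ofReal_mul (by positivity), mul_comm]
    _ ≤ _ := by gcongr

/-- The part of a boundary collar of width `t` of a bounded Lipschitz domain in a ball of radius
`ρ` centred in the domain has volume at most of order `t ρ ^ (d - 1)`. -/
theorem IsBoundedLipschitzDomain.exists_volume_collar_le {d : ℕ} (hd : 0 < d)
    {D : Set (EuclideanSpace ℝ (Fin d))} (hD : IsBoundedLipschitzDomain D)
    (hne : (frontier D).Nonempty) :
    ∃ K : ℝ≥0∞, K ≠ ∞ ∧ ∀ x ∈ D, ∀ ρ : ℝ, 0 < ρ → ∀ t : ℝ, 0 < t →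
      volume {z | x + z ∈ D ∧ ‖z‖ < ρ ∧ infDist (x + z) (frontier D) < t}
        ≤ K * ENNReal.ofReal (t * ρ ^ ((d : ℝ) - 1)) := by
  obtain ⟨hDo, hDb, r, h, hr, hh, hcone⟩ := hD
  choose! v hv hcone using hcone
  have hcompact : IsCompact (frontier D) :=
    isCompact_of_isClosed_isBounded isClosed_frontier
      (hDb.closure.subset frontier_subset_closure)
  obtain ⟨I, hI⟩ := hcompact.elim_finite_subcover
    (fun p : frontier D => ball (p : EuclideanSpace ℝ (Fin d)) (r / 2)) (fun _ => isOpen_ball)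
    fun p hp => mem_iUnion.2 ⟨⟨p, hp⟩, mem_ball_self (half_pos hr)⟩
  set M := diam D + 1 with hMdef
  have hM : 0 < M := by positivity
  set ω := volume (ball (0 : EuclideanSpace ℝ (Fin d)) 1)
  have hω : ω ≠ ∞ := measure_ball_lt_top.ne
  set C := 2 ^ d / (r * min 1 (h / M))
  set K := (I.card : ℝ≥0∞) * (ω * ENNReal.ofReal C) + ω * ENNReal.ofReal (2 * M / r) with hK
  have hsmall : ∀ x ∈ D, ∀ ρ : ℝ, 0 < ρ → ρ ≤ M → ∀ t : ℝ, 0 < t →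
      volume {z | x + z ∈ D ∧ ‖z‖ < ρ ∧ infDist (x + z) (frontier D) < t}
        ≤ K * ENNReal.ofReal (t * ρ ^ ((d : ℝ) - 1)) := by
    intro x hx ρ hρ hρM t ht
    rw [hK, add_mul]
    have hpos : 0 ≤ t * ρ ^ ((d : ℝ) - 1) := by positivity
    rcases le_or_gt t (r / 2) with htr | htr
    · refine le_add_right ?_
      have hsub : {z | x + z ∈ D ∧ ‖z‖ < ρ ∧ infDist (x + z) (frontier D) < t}
          ⊆ ⋃ p ∈ I, {z | (x + z ∈ D ∧ x + z ∈ ball (p : EuclideanSpace ℝ (Fin d)) r) ∧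
              ‖z‖ < ρ ∧ infDist (x + z) (frontier D) < t} := by
        rintro z ⟨hzD, hzρ, hzt⟩
        obtain ⟨q, hq, hzq⟩ := (infDist_lt_iff hne).1 hzt
        obtain ⟨p, hp, hqp⟩ := mem_iUnion₂.1 (hI hq)
        refine mem_iUnion₂.2 ⟨p, hp, ⟨hzD, ?_⟩, hzρ, hzt⟩
        rw [mem_ball] at hqp ⊢
        linarith [dist_triangle (x + z) q p]
      refine (measure_mono hsub).trans ((measure_biUnion_finset_le _ _).trans ?_)
      refine (Finset.sum_le_sum fun (p : frontier D) _ => volume_collar_inter_chart_le hDo hne hr hh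
        (hv p p.2) (hcone p p.2) x hρ hρM ht).trans_eq ?_
      rw [Finset.sum_const, nsmul_eq_mul, ENNReal.ofReal_mul (by positivity)]
      ring
    · refine le_add_left ?_
      have hsub : {z | x + z ∈ D ∧ ‖z‖ < ρ ∧ infDist (x + z) (frontier D) < t}
          ⊆ ball 0 ρ := fun z hz => by simpa using hz.2.1
      refine (measure_mono hsub).trans ?_
      rw [Measure.addHaar_ball_of_pos volume 0 hρ, finrank_euclideanSpace_fin, mul_comm, mul_assoc,
        ← ENNReal.ofReal_mul (by positivity)]
      gcongr
      rw [Real.rpow_sub_one hρ.ne', Real.rpow_natCast]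
      have h1 : 1 ≤ 2 * M / r * t / ρ := by
        rw [le_div_iff₀ hρ, one_mul, div_mul_eq_mul_div, le_div_iff₀ hr]
        nlinarith
      calc ρ ^ d ≤ (2 * M / r * t / ρ) * ρ ^ d := le_mul_of_one_le_left (by positivity) h1
        _ = _ := by ring
  refine ⟨K, by finiteness, fun x hx ρ hρ t ht => ?_⟩
  rcases le_or_gt ρ M with hρM | hρM
  · exact hsmall x hx ρ hρ hρM t ht
  · have hd1 : (0 : ℝ) ≤ (d : ℝ) - 1 := by
      have : (1 : ℝ) ≤ d := by exact_mod_cast hd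
      linarith
    calc _ ≤ volume {z | x + z ∈ D ∧ ‖z‖ < M ∧ infDist (x + z) (frontier D) < t} := by
          refine measure_mono fun z hz => ⟨hz.1, ?_, hz.2.2⟩
          have := dist_le_diam_of_mem hDb hz.1 hx
          rw [dist_eq_norm, add_sub_cancel_left] at this
          rw [hMdef]
          linarith
      _ ≤ K * ENNReal.ofReal (t * M ^ ((d : ℝ) - 1)) := hsmall x hx M hM le_rfl t ht
      _ ≤ _ := by gcongr

theorem lintegral_norm_rpow_compl_ball_le {d : ℕ} {s ε : ℝ} (hs : 0 < s) (hε : 0 < ε) :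
    ∫⁻ z in {z : EuclideanSpace ℝ (Fin d) | ε < ‖z‖}, ENNReal.ofReal (‖z‖ ^ (-((d : ℝ) + s)))
      ≤ volume (ball (0 : EuclideanSpace ℝ (Fin d)) 1)
        * ENNReal.ofReal (((d : ℝ) + s) / s * ε ^ (-s)) := by
  have hmeas : MeasurableSet {z : EuclideanSpace ℝ (Fin d) | ε < ‖z‖} :=
    (isOpen_lt continuous_const continuous_norm).measurableSet
  have := lintegral_rpow_neg_le (μ := volume.restrict {z : EuclideanSpace ℝ (Fin d) | ε < ‖z‖})
    (f := fun z => ‖z‖) (m := d) (q := d + s)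
    (K := volume (ball (0 : EuclideanSpace ℝ (Fin d)) 1)) measurable_norm hε (by positivity)
    (by linarith) (ae_restrict_of_forall_mem hmeas fun z hz => le_of_lt hz)
    (fun t ht => by
      refine (Measure.restrict_apply_le _ _).trans_eq ?_
      have hball : {z : EuclideanSpace ℝ (Fin d) | ‖z‖ < t} = ball 0 t := by
        ext z
        simp
      rw [hball, Measure.addHaar_ball_of_pos volume 0 ht, finrank_euclideanSpace_fin,
        Real.rpow_natCast, mul_comm])
  simpa using this

/-- The collar volume bound controls the integral of `δ_D (x + z) ^ (-a) |z| ^ (-d - s)` over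
`δ_D (x + z) > c`, `|z| ≥ R`. -/
theorem lintegral_infDist_rpow_mul_norm_rpow_le {d : ℕ} {D : Set (EuclideanSpace ℝ (Fin d))}
    (hDo : IsOpen D) {K : ℝ≥0∞} {x : EuclideanSpace ℝ (Fin d)}
    (hK : ∀ ρ : ℝ, 0 < ρ → ∀ t : ℝ, 0 < t →
      volume {z | x + z ∈ D ∧ ‖z‖ < ρ ∧ infDist (x + z) (frontier D) < t}
        ≤ K * ENNReal.ofReal (t * ρ ^ ((d : ℝ) - 1)))
    {a s c R : ℝ} (ha : 1 < a) (hs : 0 < s) (hc : 0 < c) (hR : 0 < R) :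
    ∫⁻ z in {z | (x + z ∈ D ∧ c < infDist (x + z) (frontier D)) ∧ R ≤ ‖z‖},
        ENNReal.ofReal (infDist (x + z) (frontier D) ^ (-a))
          * ENNReal.ofReal (‖z‖ ^ (-((d : ℝ) + s)))
      ≤ K * ENNReal.ofReal (a / (a - 1) * c ^ (1 - a))
        * ENNReal.ofReal (((d : ℝ) + s) / (s + 1) * R ^ (-1 - s)) := by
  set A := {z | (x + z ∈ D ∧ c < infDist (x + z) (frontier D)) ∧ R ≤ ‖z‖}
  have hadd : Continuous fun z : EuclideanSpace ℝ (Fin d) => x + z := by fun_prop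
  have hδ : Continuous fun z => infDist (x + z) (frontier D) :=
    (continuous_infDist_pt _).comp hadd
  have hA : MeasurableSet A :=
    (((hDo.preimage hadd).measurableSet).inter (isOpen_lt continuous_const hδ).measurableSet).inter
      (isClosed_le continuous_const continuous_norm).measurableSet
  have hw : Measurable fun z => ENNReal.ofReal (infDist (x + z) (frontier D) ^ (-a)) :=
    (hδ.measurable.pow_const _).ennreal_ofReal
  set ν := (volume.restrict A).withDensity
    fun z => ENNReal.ofReal (infDist (x + z) (frontier D) ^ (-a))
  have hν : ∀ ρ : ℝ, 0 < ρ → ν {z | ‖z‖ < ρ}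
      ≤ K * ENNReal.ofReal (a / (a - 1) * c ^ (1 - a)) * ENNReal.ofReal (ρ ^ ((d : ℝ) - 1)) := by
    intro ρ hρ
    have hball : MeasurableSet {z : EuclideanSpace ℝ (Fin d) | ‖z‖ < ρ} :=
      (isOpen_lt continuous_norm continuous_const).measurableSet
    rw [withDensity_apply _ hball, Measure.restrict_restrict hball, mul_right_comm]
    refine lintegral_rpow_neg_le hδ.measurable hc (by linarith) ha
      (ae_restrict_of_forall_mem (hball.inter hA) fun z hz => hz.2.1.2.le) fun t ht => ?_
    rw [Measure.restrict_apply (isOpen_lt hδ continuous_const).measurableSet, Real.rpow_one,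
      mul_assoc, ← ENNReal.ofReal_mul (by positivity), mul_comm _ t]
    refine le_trans (measure_mono ?_) (hK ρ hρ t ht)
    exact fun z hz => ⟨hz.2.2.1.1, hz.2.1, hz.1⟩
  have key := lintegral_rpow_neg_le (μ := ν) (f := fun z => ‖z‖) (m := (d : ℝ) - 1) (q := d + s)
    measurable_norm hR (by positivity) (by linarith)
    ((withDensity_absolutelyContinuous _ _).ae_le
      (ae_restrict_of_forall_mem hA fun z hz => hz.2)) hν
  rw [lintegral_withDensity_eq_lintegral_mul _ hw (by fun_prop),
    show (d : ℝ) + s - (d - 1) = s + 1 by ring, show (d : ℝ) - 1 - (d + s) = -1 - s by ring] at key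
  exact key

theorem ofReal_integral_le_lintegral_ofReal {Ω : Type*} [MeasurableSpace Ω] {μ : Measure Ω}
    {f : Ω → ℝ} (hf : 0 ≤ᵐ[μ] f) :
    ENNReal.ofReal (∫ ω, f ω ∂μ) ≤ ∫⁻ ω, ENNReal.ofReal (f ω) ∂μ := by
  by_cases h : Integrable f μ
  · exact (ofReal_integral_eq_lintegral_ofReal h hf).le
  · simp [integral_undef h]

theorem stmt_2 {d : ℕ} (hd : 0 < d) {D : Set (EuclideanSpace ℝ (Fin d))}
    (hD : IsBoundedLipschitzDomain D) {α β : ℝ} (hα : α ∈ Set.Ioo (0 : ℝ) 1)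
    (hβ : β ∈ Set.Ioo (α / 2) α) :
    ∃ C : ℝ, 0 < C ∧
      ∀ ε ∈ Set.Ioo (0 : ℝ) 1, ∀ x ∈ D,
        4 * ε < Metric.infDist x (frontier D) →
        (∫ z in {z : EuclideanSpace ℝ (Fin d) | ε < ‖z‖},
            Set.indicator {z : EuclideanSpace ℝ (Fin d) |
                x + z ∈ D ∧ 3 * ε < Metric.infDist (x + z) (frontier D)}
              (fun z =>
                Metric.infDist (x + z) (frontier D) ^ (-1 - β + α / 2) *
                  ‖z‖ ^ (-((d : ℝ) + α - β))) z)
          ≤ C * (ε ^ (-(β - α / 2)) * Metric.infDist x (frontier D) ^ (-1 - (α - β))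
              + ε ^ (-(α - β)) * Metric.infDist x (frontier D) ^ (-1 - β + α / 2)) := by
  rcases (frontier D).eq_empty_or_nonempty with hemp | hne
  · refine ⟨1, one_pos, fun ε hε x _ hx => ?_⟩
    rw [hemp, infDist_empty] at hx
    linarith [hε.1]
  obtain ⟨K, hKtop, hK⟩ := hD.exists_volume_collar_le hd hne
  obtain ⟨s, hs⟩ : ∃ s, s = α - β := ⟨_, rfl⟩
  obtain ⟨a, ha⟩ : ∃ a, a = 1 + β - α / 2 := ⟨_, rfl⟩
  have hs0 : 0 < s := by linarith [hβ.2]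
  have ha1 : 1 < a := by linarith [hβ.1]
  rw [show -1 - β + α / 2 = -a by linarith, show -(β - α / 2) = 1 - a by linarith, ← hs,
    show -((d : ℝ) + α - β) = -((d : ℝ) + s) by linarith]
  have ha0 : 0 < a - 1 := sub_pos.2 ha1
  set ω := volume (ball (0 : EuclideanSpace ℝ (Fin d)) 1)
  have hω : ω ≠ ∞ := measure_ball_lt_top.ne
  set C₁ := (1 / 2) ^ (-a) * (ω.toReal * (((d : ℝ) + s) / s)) with hC₁
  set C₂ := K.toReal * (a / (a - 1) * 3 ^ (1 - a)) *
    (((d : ℝ) + s) / (s + 1) * (1 / 2) ^ (-1 - s)) with hC₂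
  have hC₁0 : 0 ≤ C₁ := by positivity
  have hC₂0 : 0 ≤ C₂ := by positivity
  refine ⟨C₁ + C₂ + 1, by positivity, fun ε hε x hx hxε => ?_⟩
  have hε0 : 0 < ε := hε.1
  set R := infDist x (frontier D) with hRdef
  have hR : 0 < R := by linarith
  set B := {z : EuclideanSpace ℝ (Fin d) |
    x + z ∈ D ∧ 3 * ε < infDist (x + z) (frontier D)}
  set F : EuclideanSpace ℝ (Fin d) → ℝ := fun z =>
    infDist (x + z) (frontier D) ^ (-a) * ‖z‖ ^ (-((d : ℝ) + s))
  set A := {z : EuclideanSpace ℝ (Fin d) |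
    (x + z ∈ D ∧ 3 * ε < infDist (x + z) (frontier D)) ∧ R / 2 ≤ ‖z‖} with hAdef
  set G : EuclideanSpace ℝ (Fin d) → ℝ≥0∞ := fun z =>
    ENNReal.ofReal (infDist (x + z) (frontier D) ^ (-a)) * ENNReal.ofReal (‖z‖ ^ (-((d : ℝ) + s)))
  have hF0 : ∀ z, 0 ≤ F z := fun z => mul_nonneg (Real.rpow_nonneg infDist_nonneg _) (by positivity)
  have hpt : ∀ z, ENNReal.ofReal (B.indicator F z)
      ≤ ENNReal.ofReal ((R / 2) ^ (-a)) * ENNReal.ofReal (‖z‖ ^ (-((d : ℝ) + s)))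
        + A.indicator G z := by
    intro z
    by_cases hzB : z ∈ B
    · rw [indicator_of_mem hzB, ENNReal.ofReal_mul (Real.rpow_nonneg infDist_nonneg _)]
      rcases le_or_gt (R / 2) ‖z‖ with hz | hz
      · rw [indicator_of_mem (show z ∈ A from ⟨hzB, hz⟩)]
        exact le_add_self
      · refine le_add_right ?_
        refine mul_le_mul' (ENNReal.ofReal_le_ofReal
          (Real.rpow_le_rpow_of_nonpos (half_pos hR) ?_ (by linarith))) le_rfl
        have := infDist_le_infDist_add_dist (s := frontier D) (x := x) (y := x + z)
        rw [dist_eq_norm, sub_add_cancel_left, norm_neg] at this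
        linarith
    · simp [indicator_of_notMem hzB]
  have hDo : IsOpen D := hD.1
  have hA : MeasurableSet A := by
    have hadd : Continuous fun z : EuclideanSpace ℝ (Fin d) => x + z := by fun_prop
    exact (((hDo.preimage hadd).measurableSet).inter (isOpen_lt continuous_const
      ((continuous_infDist_pt _).comp hadd)).measurableSet).inter
      (isClosed_le continuous_const continuous_norm).measurableSet
  have hnear := lintegral_norm_rpow_compl_ball_le (d := d) hs0 hε0
  have hfar := lintegral_infDist_rpow_mul_norm_rpow_le hDo (hK x hx) ha1 hs0
    (by positivity : 0 < 3 * ε) (half_pos hR)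
  have hbound : ENNReal.ofReal (∫ z in {z : EuclideanSpace ℝ (Fin d) | ε < ‖z‖}, B.indicator F z)
      ≤ ENNReal.ofReal (C₁ * (ε ^ (-s) * R ^ (-a)) + C₂ * (ε ^ (1 - a) * R ^ (-1 - s))) := by
    calc _ ≤ ∫⁻ z in {z : EuclideanSpace ℝ (Fin d) | ε < ‖z‖},
            ENNReal.ofReal (B.indicator F z) :=
          ofReal_integral_le_lintegral_ofReal
            (Eventually.of_forall fun z => indicator_nonneg (fun z _ => hF0 z) z)
      _ ≤ ∫⁻ z in {z : EuclideanSpace ℝ (Fin d) | ε < ‖z‖},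
            (ENNReal.ofReal ((R / 2) ^ (-a)) * ENNReal.ofReal (‖z‖ ^ (-((d : ℝ) + s)))
              + A.indicator G z) := lintegral_mono hpt
      _ ≤ ENNReal.ofReal ((R / 2) ^ (-a)) * (ω * ENNReal.ofReal (((d : ℝ) + s) / s * ε ^ (-s)))
            + K * ENNReal.ofReal (a / (a - 1) * (3 * ε) ^ (1 - a))
              * ENNReal.ofReal (((d : ℝ) + s) / (s + 1) * (R / 2) ^ (-1 - s)) := by
          rw [lintegral_add_left (by fun_prop), lintegral_const_mul _ (by fun_prop)]
          refine add_le_add (mul_le_mul' le_rfl hnear) (le_trans ?_ hfar)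
          rw [← hAdef, ← lintegral_indicator hA]
          exact setLIntegral_le_lintegral _ _
      _ = _ := by
          rw [← ENNReal.ofReal_toReal hω, ← ENNReal.ofReal_toReal hKtop,
            ← ENNReal.ofReal_mul (by positivity), ← ENNReal.ofReal_mul (by positivity),
            ← ENNReal.ofReal_mul (by positivity), ← ENNReal.ofReal_mul (by positivity),
            ← ENNReal.ofReal_add (by positivity) (by positivity), hC₁, hC₂,
            div_eq_mul_one_div R, Real.mul_rpow hR.le (by positivity),
            Real.mul_rpow hR.le (by positivity), Real.mul_rpow (by positivity) hε0.le]
          ring_nf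
  have hP : 0 ≤ ε ^ (1 - a) * R ^ (-1 - s) := by positivity
  have hQ : 0 ≤ ε ^ (-s) * R ^ (-a) := by positivity
  refine ((ENNReal.ofReal_le_ofReal_iff (by positivity)).1 hbound).trans ?_
  nlinarith [mul_nonneg hC₁0 hP, mul_nonneg hC₂0 hQ]
end
end

section
/- Let D be a bounded Lipschitz domain in R^d and α ∈ (0,1]. There exists C > 0 such that for every ε, s ∈ (0,1) and x ∈ D, ∫_{|z|>s} ( dist(x+z,∂D)^{-1+α/2} 1_{{x+z ∈ D, dist(x+z,∂D) > 3ε}} + ε^{-1+α/2} 1_{{x+z ∈ D, dist(x+z,∂D) ≤ 3ε}} ) |z|^{-(d+α)} dz ≤ C ε^{-1+α/2} s^{-α}. -/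
noncomputable section
open MeasureTheory Metric Set Filter Topology

/-- The kernel `‖z‖ ^ (-(d + α))` is integrable away from the origin. -/
theorem integrableOn_norm_rpow_neg {d : ℕ} {α s : ℝ} (hα : 0 < α) (hs : 0 < s) :
    IntegrableOn (fun z : EuclideanSpace ℝ (Fin d) => ‖z‖ ^ (-((d : ℝ) + α)))
      {z | s < ‖z‖} := by
  have hg : Integrable (fun z : EuclideanSpace ℝ (Fin d) =>
      (s / (1 + s)) ^ (-((d : ℝ) + α)) * (1 + ‖z‖) ^ (-((d : ℝ) + α))) :=
    (integrable_one_add_norm (by simpa using hα)).const_mul _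
  refine Integrable.mono' hg.integrableOn
    (measurable_norm.pow_const _).aestronglyMeasurable ?_
  refine (ae_restrict_iff' (measurableSet_lt measurable_const measurable_norm)).2
    (Eventually.of_forall fun z (hz : s < ‖z‖) => ?_)
  rw [Real.norm_of_nonneg (by positivity), ← Real.mul_rpow (by positivity) (by positivity)]
  refine Real.rpow_le_rpow_of_nonpos (by positivity) ?_ (by linarith [d.cast_nonneg (α := ℝ)])
  rw [div_mul_eq_mul_div, div_le_iff₀ (by positivity)]
  nlinarith

open scoped Pointwise in
/-- Scaling of the tail integral of the kernel `‖z‖ ^ (-(d + α))`. -/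
theorem setIntegral_norm_rpow_neg {d : ℕ} {α s : ℝ} (hs : 0 < s) :
    ∫ z in {z : EuclideanSpace ℝ (Fin d) | s < ‖z‖}, ‖z‖ ^ (-((d : ℝ) + α)) =
      s ^ (-α) *
        ∫ z in {z : EuclideanSpace ℝ (Fin d) | 1 < ‖z‖}, ‖z‖ ^ (-((d : ℝ) + α)) := by
  have hset : s • {z : EuclideanSpace ℝ (Fin d) | 1 < ‖z‖} = {z | s < ‖z‖} := by
    ext z
    rw [Set.mem_smul_set_iff_inv_smul_mem₀ hs.ne']
    simp only [mem_ofPred_eq, norm_smul, norm_inv, Real.norm_of_nonneg hs.le]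
    rw [inv_mul_eq_div, one_lt_div hs]
  have h := Measure.setIntegral_comp_smul_of_pos volume
    (fun z : EuclideanSpace ℝ (Fin d) => ‖z‖ ^ (-((d : ℝ) + α))) {z | 1 < ‖z‖} hs
  simp only [norm_smul, Real.norm_of_nonneg hs.le, Real.mul_rpow hs.le (norm_nonneg _),
    integral_const_mul, hset, finrank_euclideanSpace, Fintype.card_fin, smul_eq_mul] at h
  have hpow : s ^ (-α) = s ^ d * s ^ (-((d : ℝ) + α)) := by
    rw [← Real.rpow_natCast, ← Real.rpow_add hs]
    ring_nf
  rw [hpow, mul_assoc, h, mul_inv_cancel_left₀ (pow_pos hs d).ne']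

theorem stmt_3 {d : ℕ} (hd : 0 < d) {D : Set (EuclideanSpace ℝ (Fin d))}
    (hD : IsBoundedLipschitzDomain D) {α : ℝ} (hα : α ∈ Set.Ioc (0 : ℝ) 1) :
    ∃ C : ℝ, 0 < C ∧
      ∀ ε ∈ Set.Ioo (0 : ℝ) 1, ∀ s ∈ Set.Ioo (0 : ℝ) 1, ∀ x ∈ D,
        (∫ z in {z : EuclideanSpace ℝ (Fin d) | s < ‖z‖},
            (Set.indicator {z : EuclideanSpace ℝ (Fin d) |
                  x + z ∈ D ∧ 3 * ε < Metric.infDist (x + z) (frontier D)}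
                (fun z => Metric.infDist (x + z) (frontier D) ^ (-1 + α / 2)) z
              + Set.indicator {z : EuclideanSpace ℝ (Fin d) |
                  x + z ∈ D ∧ Metric.infDist (x + z) (frontier D) ≤ 3 * ε}
                (fun _ => ε ^ (-1 + α / 2)) z)
              * ‖z‖ ^ (-((d : ℝ) + α)))
          ≤ C * ε ^ (-1 + α / 2) * s ^ (-α) := by
  obtain ⟨hα0, hα1⟩ := hα
  set I := ∫ z in {z : EuclideanSpace ℝ (Fin d) | 1 < ‖z‖}, ‖z‖ ^ (-((d : ℝ) + α)) with hI
  have hI0 : 0 ≤ I := integral_nonneg fun z => by positivity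
  refine ⟨I + 1, by positivity, ?_⟩
  rintro ε ⟨hε, -⟩ s ⟨hs, -⟩ x -
  have hε0 : 0 ≤ ε ^ (-1 + α / 2) := by positivity
  have hs0 : 0 ≤ s ^ (-α) := by positivity
  calc
    _ ≤ ∫ z in {z : EuclideanSpace ℝ (Fin d) | s < ‖z‖},
          ε ^ (-1 + α / 2) * ‖z‖ ^ (-((d : ℝ) + α)) := by
      refine integral_mono_of_nonneg (Eventually.of_forall fun z => ?_)
        ((integrableOn_norm_rpow_neg hα0 hs).const_mul _) (Eventually.of_forall fun z => ?_)
      · exact mul_nonneg (add_nonneg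
          (indicator_nonneg (fun _ _ => Real.rpow_nonneg infDist_nonneg _) _)
          (indicator_nonneg (fun _ _ => hε0) _)) (by positivity)
      · refine mul_le_mul_of_nonneg_right ?_ (by positivity)
        classical
        simp only [indicator_apply, mem_ofPred_eq]
        by_cases hz : x + z ∈ D
        · rcases lt_or_ge (3 * ε) (infDist (x + z) (frontier D)) with h | h
          · simpa [hz, h, h.not_ge] using
              Real.rpow_le_rpow_of_nonpos hε (by linarith) (by linarith)
          · simp [hz, h, h.not_gt]
        · simpa [hz] using hε0
    _ = I * ε ^ (-1 + α / 2) * s ^ (-α) := by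
      rw [integral_const_mul, setIntegral_norm_rpow_neg hs, ← hI]
      ring
    _ ≤ (I + 1) * ε ^ (-1 + α / 2) * s ^ (-α) := by
      gcongr
      linarith
end
end

section
/- Let K ∈ C(R^d × R^d) be symmetric (K(x,y) = K(y,x)), multivariate 1-periodic in each variable, and satisfy Λ^{-1} ≤ K ≤ Λ. For α ∈ (1,2) define F(x) := p.v. ∫_{R^d} z K(x, x+z) |z|^{-(d+α)} dz. If K is C^1 in the second variable with bounded derivative, then F is well-defined, F(x) = (1/2) ∫_{R^d} z (K(x,x+z) - K(x,x-z)) |z|^{-(d+α)} dz (absolutely convergent), F is continuous and 1-periodic, and ∫_{[0,1]^d} F(x) dx = 0. -/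
noncomputable section
open MeasureTheory Metric Set Filter Topology

/-- The lattice vector of `ℤ^d` inside `ℝ^d` corresponding to `m : Fin d → ℤ`. -/
def intVec {d : ℕ} (m : Fin d → ℤ) : EuclideanSpace ℝ (Fin d) :=
  (EuclideanSpace.equiv (Fin d) ℝ).symm fun i => (m i : ℝ)

/-- The unit cube `[0,1]^d`. -/
def unitCube (d : ℕ) : Set (EuclideanSpace ℝ (Fin d)) :=
  {x | ∀ i, x i ∈ Set.Icc (0 : ℝ) 1}

/-- `min A (B r) r ^ (1 - d - α)`, as a function of `r = ‖z‖`, is integrable on `ℝ^d`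
when `1 < α < 2`. -/
theorem integrable_min_mul_norm_rpow {d : ℕ} (hd : 0 < d) {α : ℝ} (hα : α ∈ Set.Ioo (1 : ℝ) 2)
    {A B : ℝ} (hA : 0 ≤ A) (hB : 0 ≤ B) :
    Integrable (fun z : EuclideanSpace ℝ (Fin d) =>
      min A (B * ‖z‖) * ‖z‖ ^ (-((d : ℝ) + α)) * ‖z‖) := by
  have : Nonempty (Fin d) := ⟨⟨0, hd⟩⟩
  have : Nontrivial (EuclideanSpace ℝ (Fin d)) := inferInstance
  refine (integrable_fun_norm_addHaar (volume : Measure (EuclideanSpace ℝ (Fin d)))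
    (f := fun r : ℝ => min A (B * r) * r ^ (-((d : ℝ) + α)) * r)).2 ?_
  rw [finrank_euclideanSpace, Fintype.card_fin]
  have hmeas : Measurable fun y : ℝ =>
      y ^ (d - 1) • (min A (B * y) * y ^ (-((d : ℝ) + α)) * y) := by
    simp only [smul_eq_mul]; fun_prop
  have key : ∀ y : ℝ, 0 < y →
      y ^ (d - 1) • (min A (B * y) * y ^ (-((d : ℝ) + α)) * y) = min A (B * y) * y ^ (-α) := by
    intro y hy
    have h : y ^ (d - 1) * y = y ^ (d : ℝ) := by
      rw [← pow_succ, Nat.sub_add_cancel hd, Real.rpow_natCast]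
    rw [smul_eq_mul]
    calc _ = min A (B * y) * ((y ^ (d - 1) * y) * y ^ (-((d : ℝ) + α))) := by ring
      _ = _ := by rw [h, ← Real.rpow_add hy]; congr 2; ring
  rw [← Ioc_union_Ioi_eq_Ioi zero_le_one]
  refine IntegrableOn.union ?_ ?_
  · have hint : IntegrableOn (fun y : ℝ => B * y ^ (1 - α)) (Ioc 0 1) :=
      ((intervalIntegrable_iff_integrableOn_Ioc_of_le zero_le_one).1
        (intervalIntegral.intervalIntegrable_rpow' (by linarith [hα.2]))).const_mul B
    refine Integrable.mono' hint hmeas.aestronglyMeasurable ?_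
    refine ae_restrict_of_forall_mem measurableSet_Ioc fun y hy => ?_
    have h1 : y ^ (1 - α) = y * y ^ (-α) := by
      rw [sub_eq_add_neg, Real.rpow_add hy.1, Real.rpow_one]
    have hy0 := hy.1
    rw [key y hy.1, Real.norm_of_nonneg (by positivity), h1, ← mul_assoc]
    gcongr
    exact min_le_right _ _
  · have hint : IntegrableOn (fun y : ℝ => A * y ^ (-α)) (Ioi 1) :=
      (integrableOn_Ioi_rpow_of_lt (by linarith [hα.1]) zero_lt_one).const_mul A
    refine Integrable.mono' hint hmeas.aestronglyMeasurable ?_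
    refine ae_restrict_of_forall_mem measurableSet_Ioi fun y hy => ?_
    have hy0 : 0 < y := zero_lt_one.trans hy
    rw [key y hy0, Real.norm_of_nonneg (by positivity)]
    gcongr
    exact min_le_left _ _

/-- The closed unit cube agrees almost everywhere with the half-open fundamental domain of
`ℤ^d`. -/
theorem unitCube_ae_eq_fundamentalDomain (d : ℕ) :
    (unitCube d : Set (EuclideanSpace ℝ (Fin d))) =ᵐ[volume]
      ZSpan.fundamentalDomain (EuclideanSpace.basisFun (Fin d) ℝ).toBasis := by
  have h := (Measure.univ_pi_Ico_ae_eq_Icc (μ := fun _ : Fin d => (volume : Measure ℝ))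
    (f := fun _ => (0 : ℝ)) (g := fun _ => 1)).symm
  have h' := (EuclideanSpace.volume_preserving_symm_measurableEquiv_toLp
    (Fin d)).quasiMeasurePreserving.preimage_ae_eq h
  have h1 : unitCube d = (MeasurableEquiv.toLp 2 (Fin d → ℝ)).symm ⁻¹'
      Icc (fun _ => (0 : ℝ)) (fun _ => 1) := by
    ext x
    simp [unitCube, Pi.le_def, forall_and]
  have h2 : ZSpan.fundamentalDomain (EuclideanSpace.basisFun (Fin d) ℝ).toBasis =
      (MeasurableEquiv.toLp 2 (Fin d → ℝ)).symm ⁻¹'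
        Set.univ.pi fun _ => Ico (0 : ℝ) 1 := by
    ext x
    simp [Set.mem_pi]
  rw [h1, h2]
  exact h'

theorem volume_unitCube_lt_top (d : ℕ) : volume (unitCube d) < ⊤ := by
  rw [measure_congr (unitCube_ae_eq_fundamentalDomain d)]
  exact (ZSpan.fundamentalDomain_isBounded _).measure_lt_top

open scoped Pointwise in
/-- The integral of a `ℤ^d`-periodic function over the unit cube is translation invariant. -/
theorem setIntegral_unitCube_add {d : ℕ} {F : Type*} [NormedAddCommGroup F] [NormedSpace ℝ F]
    (h : EuclideanSpace ℝ (Fin d) → F) (hper : ∀ x (m : Fin d → ℤ), h (x + intVec m) = h x)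
    (z : EuclideanSpace ℝ (Fin d)) :
    ∫ x in unitCube d, h (x + z) = ∫ x in unitCube d, h x := by
  set b := (EuclideanSpace.basisFun (Fin d) ℝ).toBasis with hb
  have hD := ZSpan.isAddFundamentalDomain b (volume : Measure (EuclideanSpace ℝ (Fin d)))
  have hinv : ∀ (g : Submodule.span ℤ (Set.range b)) (x : EuclideanSpace ℝ (Fin d)),
      h (g +ᵥ x) = h x := by
    intro g x
    have hg := (b.mem_span_iff_repr_mem ℤ _).mp g.2
    choose m hm using hg
    have : (g : EuclideanSpace ℝ (Fin d)) = intVec m := by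
      ext i
      have := hm i
      simp [hb] at this
      simp [intVec, this]
    rw [Submodule.vadd_def, vadd_eq_add, this, add_comm, hper]
  have : VAddInvariantMeasure (Submodule.span ℤ (Set.range b)) (EuclideanSpace ℝ (Fin d))
      volume :=
    inferInstanceAs <| VAddInvariantMeasure (Submodule.span ℤ (Set.range b)).toAddSubgroup _ volume
  have hD' := hD.vadd_of_comm z
  have h1 := hD'.setIntegral_eq hD hinv
  rw [setIntegral_congr_set (unitCube_ae_eq_fundamentalDomain d),
    setIntegral_congr_set (unitCube_ae_eq_fundamentalDomain d), ← h1]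
  have h2 := (measurePreserving_add_right volume z).setIntegral_preimage_emb
    (MeasurableEquiv.addRight z).measurableEmbedding h
    (z +ᵥ ZSpan.fundamentalDomain b)
  rw [← h2]
  congr 2
  ext x
  simp [hb, Set.mem_vadd_set_iff_neg_vadd_mem]

theorem stmt_10 {d : ℕ} (hd : 0 < d) {α : ℝ} (hα : α ∈ Set.Ioo (1 : ℝ) 2)
    {Λ : ℝ} (hΛ : 1 ≤ Λ)
    (K : EuclideanSpace ℝ (Fin d) → EuclideanSpace ℝ (Fin d) → ℝ)
    (hKcont : Continuous (Function.uncurry K))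
    (hKsym : ∀ x y, K x y = K y x)
    (hKper : ∀ x y (m : Fin d → ℤ),
        K (x + intVec m) y = K x y ∧ K x (y + intVec m) = K x y)
    (hKbdd : ∀ x y, Λ⁻¹ ≤ K x y ∧ K x y ≤ Λ)
    (hKC1 : ∀ x, ContDiff ℝ 1 (K x))
    (Mder : ℝ) (hKder : ∀ x y, ‖fderiv ℝ (K x) y‖ ≤ Mder) :
    -- the symmetrized integral converges absolutely,
    (∀ x, Integrable (fun z : EuclideanSpace ℝ (Fin d) =>
        ((K x (x + z) - K x (x - z)) * ‖z‖ ^ (-((d : ℝ) + α))) • z)) ∧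
    -- and, denoting by `F` half of its value,
    (let F : EuclideanSpace ℝ (Fin d) → EuclideanSpace ℝ (Fin d) := fun x =>
        (2 : ℝ)⁻¹ • ∫ z : EuclideanSpace ℝ (Fin d),
          ((K x (x + z) - K x (x - z)) * ‖z‖ ^ (-((d : ℝ) + α))) • z
     -- the principal value defining `F` exists and equals that value,
     (∀ x, Filter.Tendsto
        (fun r : ℝ => ∫ z in {z : EuclideanSpace ℝ (Fin d) | r < ‖z‖},
          (K x (x + z) * ‖z‖ ^ (-((d : ℝ) + α))) • z)
        (nhdsWithin 0 (Set.Ioi 0)) (nhds (F x))) ∧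
     -- `F` is continuous, `1`-periodic, and has mean zero over the unit cube
     Continuous F ∧
     (∀ x (m : Fin d → ℤ), F (x + intVec m) = F x) ∧
     (∫ x in unitCube d, F x) = 0) := by
  have hΛ0 : 0 < Λ := by linarith
  have hM0 : 0 ≤ Mder := (norm_nonneg _).trans (hKder 0 0)
  set M := Mder + 1 with hMdef
  have hM : 0 < M := by positivity
  have hKabs : ∀ x y, |K x y| ≤ Λ := fun x y =>
    abs_le.2 ⟨by linarith [(hKbdd x y).1, inv_pos.2 hΛ0], (hKbdd x y).2⟩
  have hdiff : ∀ x z, |K x (x + z) - K x (x - z)| ≤ min (2 * Λ) (2 * M * ‖z‖) := by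
    intro x z
    refine le_min ?_ ?_
    · have := abs_sub (K x (x + z)) (K x (x - z))
      linarith [hKabs x (x + z), hKabs x (x - z)]
    · have h := Convex.norm_image_sub_le_of_norm_fderiv_le (𝕜 := ℝ) (f := K x) (C := Mder)
        (fun y _ => (hKC1 x).differentiable one_ne_zero y) (fun y _ => hKder x y) convex_univ
        (mem_univ (x - z)) (mem_univ (x + z))
      have h2 : x + z - (x - z) = (2 : ℝ) • z := by rw [two_smul]; abel
      rw [h2, norm_smul, Real.norm_eq_abs, Real.norm_of_nonneg zero_le_two] at h
      nlinarith [norm_nonneg z]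
  set G : EuclideanSpace ℝ (Fin d) → EuclideanSpace ℝ (Fin d) → EuclideanSpace ℝ (Fin d) :=
    fun x z => ((K x (x + z) - K x (x - z)) * ‖z‖ ^ (-((d : ℝ) + α))) • z with hG
  set g : EuclideanSpace ℝ (Fin d) → ℝ := fun z =>
    min (2 * Λ) (2 * M * ‖z‖) * ‖z‖ ^ (-((d : ℝ) + α)) * ‖z‖ with hg
  have hgint : Integrable g := integrable_min_mul_norm_rpow hd hα (by positivity) (by positivity)
  have hGg : ∀ x z, ‖G x z‖ ≤ g z := by
    intro x z
    simp only [hG, hg, norm_smul, norm_mul, Real.norm_eq_abs]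
    rw [abs_of_nonneg (a := ‖z‖ ^ (-((d : ℝ) + α))) (by positivity)]
    gcongr
    exact hdiff x z
  have hKm : Measurable (Function.uncurry K) := hKcont.measurable
  have hKm1 : Measurable fun p : EuclideanSpace ℝ (Fin d) × EuclideanSpace ℝ (Fin d) =>
      K p.1 (p.1 + p.2) := hKm.comp (measurable_fst.prodMk (measurable_fst.add measurable_snd))
  have hKm2 : Measurable fun p : EuclideanSpace ℝ (Fin d) × EuclideanSpace ℝ (Fin d) =>
      K p.1 (p.1 - p.2) := hKm.comp (measurable_fst.prodMk (measurable_fst.sub measurable_snd))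
  have hGm : Measurable (Function.uncurry G) :=
    ((hKm1.sub hKm2).mul (measurable_snd.norm.pow_const _)).smul measurable_snd
  have hGx : ∀ x, Integrable (G x) := fun x =>
    hgint.mono' (hGm.comp measurable_prodMk_left).aestronglyMeasurable (ae_of_all _ (hGg x))
  have hGcont : ∀ z, Continuous fun x => G x z := by
    intro z
    have h1 : Continuous fun x => K x (x + z) :=
      hKcont.comp (continuous_id.prodMk (continuous_id.add continuous_const))
    have h2 : Continuous fun x => K x (x - z) :=
      hKcont.comp (continuous_id.prodMk (continuous_id.sub continuous_const))
    exact ((h1.sub h2).mul continuous_const).smul continuous_const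
  have hKper2 : ∀ x y (m : Fin d → ℤ), K (x + intVec m) (y + intVec m) = K x y :=
    fun x y m => by rw [(hKper _ _ m).1, (hKper _ _ m).2]
  have hGper : ∀ x z (m : Fin d → ℤ), G (x + intVec m) z = G x z := by
    intro x z m
    simp only [hG]
    rw [add_right_comm, hKper2, add_sub_right_comm, hKper2]
  refine ⟨hGx, ?_, ?_, ?_, ?_⟩
  · intro x
    set H : EuclideanSpace ℝ (Fin d) → EuclideanSpace ℝ (Fin d) := fun z =>
      (K x (x + z) * ‖z‖ ^ (-((d : ℝ) + α))) • z with hH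
    have hHm : Measurable H :=
      ((hKm1.comp (measurable_prodMk_left (x := x))).mul (measurable_norm.pow_const _)).smul
        measurable_id
    have hSm : ∀ r : ℝ, MeasurableSet {z : EuclideanSpace ℝ (Fin d) | r < ‖z‖} := fun r =>
      measurableSet_lt measurable_const measurable_norm
    have hHint : ∀ r : ℝ, 0 < r → IntegrableOn H {z | r < ‖z‖} := by
      intro r hr
      set c := min (2 * Λ) (2 * M * r) with hc
      have hc0 : 0 < c := lt_min (by positivity) (by positivity)
      refine Integrable.mono' (hgint.const_mul (Λ / c)).integrableOn
        hHm.aestronglyMeasurable (ae_restrict_of_forall_mem (hSm r) fun z hz => ?_)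
      have hcz : c ≤ min (2 * Λ) (2 * M * ‖z‖) := by
        have : r ≤ ‖z‖ := le_of_lt hz
        rw [hc]; gcongr
      have hk : |K x (x + z)| ≤ Λ / c * min (2 * Λ) (2 * M * ‖z‖) :=
        calc |K x (x + z)| ≤ Λ := hKabs _ _
          _ = Λ / c * c := by field_simp
          _ ≤ _ := by gcongr
      simp only [hH, hg, norm_smul, norm_mul, Real.norm_eq_abs]
      rw [abs_of_nonneg (a := ‖z‖ ^ (-((d : ℝ) + α))) (by positivity), ← mul_assoc, ← mul_assoc]
      gcongr
    have hsymm : ∀ r : ℝ, 0 < r → ∫ z in {z | r < ‖z‖}, H z =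
        (2 : ℝ)⁻¹ • ∫ z in {z | r < ‖z‖}, G x z := by
      intro r hr
      have hpre : (fun z : EuclideanSpace ℝ (Fin d) => -z) ⁻¹' {z | r < ‖z‖} = {z | r < ‖z‖} := by
        ext z; simp
      have hmp := Measure.measurePreserving_neg (volume : Measure (EuclideanSpace ℝ (Fin d)))
      have hemb := (MeasurableEquiv.neg (EuclideanSpace ℝ (Fin d))).measurableEmbedding
      have e1 : ∫ z in {z | r < ‖z‖}, H (-z) = ∫ z in {z | r < ‖z‖}, H z := by
        have := hmp.setIntegral_preimage_emb hemb H {z | r < ‖z‖}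
        rwa [hpre] at this
      have i1 : IntegrableOn (fun z => H (-z)) {z | r < ‖z‖} := by
        have := (hmp.integrableOn_comp_preimage hemb (f := H) (s := {z | r < ‖z‖})).2 (hHint r hr)
        rwa [hpre] at this
      have e2 : ∀ z, G x z = H z + H (-z) := by
        intro z
        simp only [hG, hH, norm_neg, smul_neg, ← sub_eq_add_neg, ← sub_smul, sub_mul]
      simp_rw [e2]
      rw [integral_add (hHint r hr) i1, e1, ← two_smul ℝ, smul_smul]
      norm_num
    have hlim : Tendsto (fun r : ℝ => ∫ z in {z | r < ‖z‖}, G x z) (nhdsWithin 0 (Ioi 0))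
        (𝓝 (∫ z, G x z)) := by
      simp_rw [← integral_indicator (hSm _)]
      refine tendsto_integral_filter_of_dominated_convergence g ?_ ?_ hgint ?_
      · exact Eventually.of_forall fun r => ((hGx x).1.indicator (hSm r))
      · exact Eventually.of_forall fun r => ae_of_all _ fun z =>
          (norm_indicator_le_norm_self _ _).trans (hGg x z)
      · refine ae_of_all _ fun z => ?_
        by_cases hz : z = 0
        · have : ∀ r : ℝ, Set.indicator {z | r < ‖z‖} (G x) z = G x z := by
            intro r
            simp [Set.indicator_apply, hG, hz]
          simp_rw [this]
          exact tendsto_const_nhds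
        · refine tendsto_const_nhds.congr' ?_
          filter_upwards [nhdsWithin_le_nhds (Iio_mem_nhds (norm_pos_iff.2 hz))] with r hr
          rw [Set.indicator_of_mem]
          exact hr
    refine (hlim.const_smul (2 : ℝ)⁻¹).congr' ?_
    filter_upwards [self_mem_nhdsWithin] with r hr
    exact (hsymm r hr).symm
  · exact (continuous_of_dominated (fun x => (hGx x).1) (fun x => ae_of_all _ (hGg x)) hgint
      (ae_of_all _ hGcont)).const_smul (2 : ℝ)⁻¹
  · intro x m
    exact congrArg _ (integral_congr_ae (ae_of_all _ fun z => hGper x z m))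
  · have : IsFiniteMeasure (volume.restrict (unitCube d)) :=
      isFiniteMeasure_restrict.2 (volume_unitCube_lt_top d).ne
    have hprod : Integrable (Function.uncurry G)
        ((volume.restrict (unitCube d)).prod volume) :=
      (hgint.comp_snd (volume.restrict (unitCube d))).mono' hGm.aestronglyMeasurable
        (ae_of_all _ fun p => hGg p.1 p.2)
    rw [integral_smul, integral_integral_swap hprod]
    suffices h0 : ∀ z, ∫ x in unitCube d, G x z = 0 by simp [h0]
    intro z
    have hbint : ∀ f : EuclideanSpace ℝ (Fin d) → ℝ, Measurable f → (∀ x, |f x| ≤ Λ) →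
        Integrable f (volume.restrict (unitCube d)) := fun f hf hb =>
      (integrable_const Λ).mono' hf.aestronglyMeasurable (ae_of_all _ hb)
    have i1 := hbint (fun x => K x (x + z)) (hKm1.comp (measurable_prodMk_right (y := z))) fun x => hKabs _ _
    have i2 := hbint (fun x => K x (x - z)) (hKm2.comp (measurable_prodMk_right (y := z))) fun x => hKabs _ _
    have htr : ∫ x in unitCube d, K x (x + z) = ∫ x in unitCube d, K x (x - z) := by
      rw [← setIntegral_unitCube_add (fun x => K x (x - z)) _ z]
      · simp_rw [add_sub_cancel_right, hKsym (_ + z)]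
      · intro x m
        rw [add_sub_right_comm, hKper2]
    simp only [hG]
    rw [integral_smul_const, integral_mul_const, integral_sub i1 i2, htr]
    simp
end
end

section
/- Let D be a bounded Lipschitz domain in R^d, α ∈ (0,2), and K̄ > 0. Let f vanish outside D with |∇^k f(x)| ≤ M dist(x,∂D)^{-k+α/2} for k = 0,...,3 on D, and let η_ε be the boundary cut-off as above with f_ε = f η_ε. Let L̄g(x) = p.v. ∫ (g(x+z) - g(x)) K̄ |z|^{-(d+α)} dz. Then there exists C > 0 such that for all ε ∈ (0,1) and x ∈ D, |L̄ f_ε(x) - η_ε(x) L̄ f(x)| ≤ C ( ε dist(x,∂D)^{-1-α/2} 1_{{dist(x,∂D) > 4ε}}(x) + ε^{-α/2} 1_{{dist(x,∂D) ≤ 4ε}}(x) ). -/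
noncomputable section
open MeasureTheory Metric Set Filter Topology

section RadialIntegrals

/-- The dimensional constant in polar coordinates. -/
def polarConst {E : Type*} [NormedAddCommGroup E] [NormedSpace ℝ E] [MeasurableSpace E]
    (μ : Measure E) : ℝ :=
  Module.finrank ℝ E * μ.real (ball 0 1)

lemma polarConst_nonneg {E : Type*} [NormedAddCommGroup E] [NormedSpace ℝ E] [MeasurableSpace E]
    (μ : Measure E) : 0 ≤ polarConst μ := by
  unfold polarConst
  positivity

lemma pow_finrank_sub_one_mul_rpow {E : Type*} [NormedAddCommGroup E] [NormedSpace ℝ E]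
    [FiniteDimensional ℝ E] [Nontrivial E] {y : ℝ} (hy : 0 < y) (s : ℝ) :
    y ^ (Module.finrank ℝ E - 1) * y ^ (-(Module.finrank ℝ E : ℝ) + s) = y ^ (s - 1) := by
  have h1 : 1 ≤ Module.finrank ℝ E := Module.finrank_pos
  rw [← Real.rpow_natCast, ← Real.rpow_add hy]
  congr 1
  push_cast [h1]
  ring

variable {E : Type*} [NormedAddCommGroup E] [NormedSpace ℝ E] [FiniteDimensional ℝ E]
  [Nontrivial E] [MeasurableSpace E] [BorelSpace E] (μ : Measure E) [μ.IsAddHaarMeasure]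

lemma integrable_rpow_norm_tail {β ρ : ℝ} (hβ : 0 < β) (hρ : 0 < ρ) :
    IntegrableOn (fun z : E => ‖z‖ ^ (-(Module.finrank ℝ E : ℝ) + -β)) {z | ρ < ‖z‖} μ ∧
    ∫ z in {z : E | ρ < ‖z‖}, ‖z‖ ^ (-(Module.finrank ℝ E : ℝ) + -β) ∂μ
      = polarConst μ / β * ρ ^ (-β) := by
  have hm : MeasurableSet {z : E | ρ < ‖z‖} := measurableSet_lt measurable_const measurable_norm
  set φ : ℝ → ℝ := (Ioi ρ).indicator fun y => y ^ (-(Module.finrank ℝ E : ℝ) + -β) with hφ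
  have hind : ({z : E | ρ < ‖z‖}.indicator fun z : E => ‖z‖ ^ (-(Module.finrank ℝ E : ℝ) + -β))
      = fun z => φ ‖z‖ := by
    ext z; simp [hφ, indicator]
  have hrad : EqOn (fun y : ℝ => y ^ (Module.finrank ℝ E - 1) • φ y)
      ((Ioi ρ).indicator fun y => y ^ (-β - 1)) (Ioi 0) := by
    intro y hy
    by_cases h : ρ < y
    · simp only [hφ, smul_eq_mul, indicator_of_mem (mem_Ioi.2 h)]
      exact pow_finrank_sub_one_mul_rpow hy _
    · simp [hφ, h]
  have hsub : Ioi (0 : ℝ) ∩ Ioi ρ = Ioi ρ := by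
    rw [Ioi_inter_Ioi, max_eq_right hρ.le]
  constructor
  · rw [← integrable_indicator_iff hm, hind, integrable_fun_norm_addHaar,
      integrableOn_congr_fun hrad measurableSet_Ioi, IntegrableOn,
      integrable_indicator_iff measurableSet_Ioi, IntegrableOn,
      Measure.restrict_restrict measurableSet_Ioi, inter_comm, hsub]
    exact integrableOn_Ioi_rpow_of_lt (by linarith) hρ
  · rw [← integral_indicator hm, hind, integral_fun_norm_addHaar,
      setIntegral_congr_fun measurableSet_Ioi hrad, setIntegral_indicator measurableSet_Ioi, hsub,
      integral_Ioi_rpow_of_lt (by linarith) hρ]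
    simp only [nsmul_eq_mul, smul_eq_mul, polarConst, sub_add_cancel]
    field_simp

lemma integrable_rpow_norm_closedBall {β ρ : ℝ} (hβ : 0 < β) (hρ : 0 < ρ) :
    IntegrableOn (fun z : E => ‖z‖ ^ (-(Module.finrank ℝ E : ℝ) + β)) {z | ‖z‖ ≤ ρ} μ ∧
    ∫ z in {z : E | ‖z‖ ≤ ρ}, ‖z‖ ^ (-(Module.finrank ℝ E : ℝ) + β) ∂μ
      = polarConst μ / β * ρ ^ β := by
  have hm : MeasurableSet {z : E | ‖z‖ ≤ ρ} := measurableSet_le measurable_norm measurable_const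
  set φ : ℝ → ℝ := (Iic ρ).indicator fun y => y ^ (-(Module.finrank ℝ E : ℝ) + β) with hφ
  have hind : ({z : E | ‖z‖ ≤ ρ}.indicator fun z : E => ‖z‖ ^ (-(Module.finrank ℝ E : ℝ) + β))
      = fun z => φ ‖z‖ := by
    ext z; simp [hφ, indicator]
  have hrad : EqOn (fun y : ℝ => y ^ (Module.finrank ℝ E - 1) • φ y)
      ((Iic ρ).indicator fun y => y ^ (β - 1)) (Ioi 0) := by
    intro y hy
    by_cases h : y ≤ ρ
    · simp only [hφ, smul_eq_mul, indicator_of_mem (mem_Iic.2 h)]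
      exact pow_finrank_sub_one_mul_rpow hy _
    · simp [hφ, h]
  have hsub : Ioi (0 : ℝ) ∩ Iic ρ = Ioc 0 ρ := rfl
  constructor
  · rw [← integrable_indicator_iff hm, hind, integrable_fun_norm_addHaar,
      integrableOn_congr_fun hrad measurableSet_Ioi, IntegrableOn,
      integrable_indicator_iff measurableSet_Iic, IntegrableOn,
      Measure.restrict_restrict measurableSet_Iic, inter_comm, hsub]
    exact (intervalIntegral.intervalIntegrable_rpow' (by linarith)).1
  · rw [← integral_indicator hm, hind, integral_fun_norm_addHaar,
      setIntegral_congr_fun measurableSet_Ioi hrad, setIntegral_indicator measurableSet_Iic, hsub,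
      ← intervalIntegral.integral_of_le hρ.le, integral_rpow (Or.inl (by linarith))]
    simp only [nsmul_eq_mul, smul_eq_mul, polarConst, sub_add_cancel, Real.zero_rpow hβ.ne',
      sub_zero]
    field_simp

/-- An integrand which is dominated by an integrable power of `‖z‖` near the origin and by another
one at infinity. -/
lemma norm_setIntegral_le_of_norm_le_rpow {p q ρ P Q : ℝ} (hp : 0 < p) (hq : 0 < q) (hρ : 0 < ρ)
    (hP : 0 ≤ P) (hQ : 0 ≤ Q) {F : E → ℝ} (S : Set E)
    (hnear : ∀ z, ‖z‖ ≤ ρ → ‖F z‖ ≤ P * ‖z‖ ^ (-(Module.finrank ℝ E : ℝ) + p))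
    (hfar : ∀ z, ρ < ‖z‖ → ‖F z‖ ≤ Q * ‖z‖ ^ (-(Module.finrank ℝ E : ℝ) + -q)) :
    ‖∫ z in S, F z ∂μ‖
      ≤ polarConst μ / p * (P * ρ ^ p) + polarConst μ / q * (Q * ρ ^ (-q)) := by
  have hm1 : MeasurableSet {z : E | ρ < ‖z‖} := measurableSet_lt measurable_const measurable_norm
  have hm2 : MeasurableSet {z : E | ‖z‖ ≤ ρ} := measurableSet_le measurable_norm measurable_const
  obtain ⟨hi1, he1⟩ := integrable_rpow_norm_tail μ hq hρ
  obtain ⟨hi2, he2⟩ := integrable_rpow_norm_closedBall μ hp hρ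
  set g1 : E → ℝ := {z : E | ρ < ‖z‖}.indicator
    fun z => Q * ‖z‖ ^ (-(Module.finrank ℝ E : ℝ) + -q) with hg1
  set g2 : E → ℝ := {z : E | ‖z‖ ≤ ρ}.indicator
    fun z => P * ‖z‖ ^ (-(Module.finrank ℝ E : ℝ) + p) with hg2
  have hint1 : Integrable g1 μ := (integrable_indicator_iff hm1).2 (hi1.const_mul Q)
  have hint2 : Integrable g2 μ := (integrable_indicator_iff hm2).2 (hi2.const_mul P)
  have hg1' : ∀ z, 0 ≤ g1 z := fun z => indicator_nonneg (fun _ _ => by positivity) z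
  have hg2' : ∀ z, 0 ≤ g2 z := fun z => indicator_nonneg (fun _ _ => by positivity) z
  have hle : ∀ z, ‖F z‖ ≤ g2 z + g1 z := by
    intro z
    rcases le_or_gt ‖z‖ ρ with h | h
    · have : g2 z = _ := indicator_of_mem (s := {z : E | ‖z‖ ≤ ρ}) h _
      linarith [hnear z h, hg1' z]
    · have : g1 z = _ := indicator_of_mem (s := {z : E | ρ < ‖z‖}) h _
      linarith [hfar z h, hg2' z]
  calc ‖∫ z in S, F z ∂μ‖ ≤ ∫ z in S, (g2 z + g1 z) ∂μ :=
        norm_integral_le_of_norm_le (hint2.add hint1).integrableOn (ae_of_all _ hle)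
    _ ≤ ∫ z, (g2 z + g1 z) ∂μ :=
        setIntegral_le_integral (hint2.add hint1)
          (ae_of_all _ fun z => add_nonneg (hg2' z) (hg1' z))
    _ = _ := by
        rw [integral_add hint2 hint1, hg1, hg2, integral_indicator hm1, integral_indicator hm2,
          integral_const_mul, integral_const_mul, he1, he2]
        ring

end RadialIntegrals

/-- A set with `N` disjoint translates inside `U`, along which `G` is comparable, carries at most
`N⁻¹` of the mass of `G` on `U`. -/
lemma card_mul_setLIntegral_le_of_disjoint_translates {E : Type*} [NormedAddCommGroup E]
    [MeasurableSpace E] [BorelSpace E] (μ : Measure E) [μ.IsAddRightInvariant]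
    {A U : Set E} (hA : MeasurableSet A) {G : E → ENNReal} (hG : Measurable G) (N : ℕ)
    (t : ℕ → E) (κ : ENNReal)
    (hdisj : ∀ i < N, ∀ j < N, i < j → ∀ a ∈ A, ∀ b ∈ A, a + t i ≠ b + t j)
    (hU : ∀ j < N, ∀ a ∈ A, a + t j ∈ U)
    (hκ : ∀ j < N, ∀ a ∈ A, G a ≤ κ * G (a + t j)) :
    N * ∫⁻ a in A, G a ∂μ ≤ κ * ∫⁻ a in U, G a ∂μ := by
  set B : ℕ → Set E := fun j => (fun w => w - t j) ⁻¹' A with hB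
  have hBm : ∀ j, MeasurableSet (B j) := fun j => (measurable_sub_const (t j)) hA
  have hstep : ∀ j < N, ∫⁻ a in A, G a ∂μ ≤ κ * ∫⁻ w in B j, G w ∂μ := by
    intro j hj
    calc ∫⁻ a in A, G a ∂μ ≤ ∫⁻ a in A, κ * G (a + t j) ∂μ :=
          setLIntegral_mono' hA fun a ha => hκ j hj a ha
      _ = κ * ∫⁻ a in A, G (a + t j) ∂μ :=
          lintegral_const_mul _ (hG.comp (measurable_add_const _))
      _ = κ * ∫⁻ w in B j, G w ∂μ := by
          congr 1
          rw [← lintegral_indicator hA, ← lintegral_indicator (hBm j),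
            ← lintegral_add_right_eq_self (fun w => (B j).indicator G w) (t j)]
          congr 1
          ext a
          have hmem : a + t j ∈ B j ↔ a ∈ A := by
            change a + t j - t j ∈ A ↔ a ∈ A
            rw [add_sub_cancel_right]
          by_cases ha : a ∈ A
          · rw [indicator_of_mem ha, indicator_of_mem (hmem.2 ha)]
          · rw [indicator_of_notMem ha, indicator_of_notMem (hmem.not.2 ha)]
  have hpd : (↑(Finset.range N) : Set ℕ).PairwiseDisjoint B := by
    have key : ∀ i < N, ∀ j < N, i < j → Disjoint (B i) (B j) := fun i hi j hj hij =>
      disjoint_left.2 fun w hwi hwj => hdisj i hi j hj hij _ hwi _ hwj (by simp)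
    intro i hi j hj hne
    have hi' : i < N := by simpa using hi
    have hj' : j < N := by simpa using hj
    rcases lt_or_gt_of_ne hne with h | h
    · exact key i hi' j hj' h
    · exact (key j hj' i hi' h).symm
  calc N * ∫⁻ a in A, G a ∂μ = ∑ j ∈ Finset.range N, ∫⁻ a in A, G a ∂μ := by simp
    _ ≤ ∑ j ∈ Finset.range N, κ * ∫⁻ w in B j, G w ∂μ :=
        Finset.sum_le_sum fun j hj => hstep j (Finset.mem_range.1 hj)
    _ = κ * ∫⁻ w in ⋃ j ∈ Finset.range N, B j, G w ∂μ := by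
        rw [← Finset.mul_sum, lintegral_biUnion_finset hpd fun j _ => hBm j]
    _ ≤ κ * ∫⁻ a in U, G a ∂μ := by
        gcongr
        refine iUnion₂_subset fun j hj w hw => ?_
        simpa using hU j (Finset.mem_range.1 hj) _ hw

lemma infDist_frontier_le_dist {E : Type*} [NormedAddCommGroup E] [NormedSpace ℝ E] {D : Set E}
    (hD : IsOpen D) {x y : E} (hx : x ∈ D) (hy : y ∉ D) : infDist x (frontier D) ≤ dist x y := by
  have hex : ∃ z ∈ segment ℝ x y, z ∈ frontier D := by
    by_contra! hne
    have hsub : segment ℝ x y ⊆ D ∪ (closure D)ᶜ := by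
      intro z hz
      by_cases hzD : z ∈ D
      · exact Or.inl hzD
      · refine Or.inr fun hzc => hne z hz ?_
        rw [hD.frontier_eq]
        exact ⟨hzc, hzD⟩
    have hdisj : Disjoint D (closure D)ᶜ :=
      disjoint_left.2 fun z hz hz' => hz' (subset_closure hz)
    exact hy ((convex_segment x y).isPreconnected.subset_left_of_subset_union hD
      isClosed_closure.isOpen_compl hdisj hsub ⟨x, left_mem_segment ℝ x y, hx⟩
      (right_mem_segment ℝ x y))
  obtain ⟨z, hz, hzf⟩ := hex
  have := dist_add_dist_of_mem_segment hz
  linarith [infDist_le_dist_of_mem (x := x) hzf, dist_nonneg (x := z) (y := y)]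

lemma le_infDist_frontier_of_ball_subset {X : Type*} [PseudoMetricSpace X] {D : Set X}
    (hD : IsOpen D) (hne : (frontier D).Nonempty) {x : X} {ρ : ℝ} (h : ball x ρ ⊆ D) :
    ρ ≤ infDist x (frontier D) := by
  rw [le_infDist hne]
  intro q hq
  by_contra! hlt
  rw [hD.frontier_eq] at hq
  exact hq.2 (h (by rwa [mem_ball, dist_comm]))

lemma rpow_neg_le_two_rpow_mul {s u w : ℝ} (hs : 0 ≤ s) (hw : 0 < w) (h : w ≤ 2 * u) :
    u ^ (-s) ≤ 2 ^ s * w ^ (-s) := by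
  have hu : 0 < u := by linarith
  calc u ^ (-s) = 2 ^ s * (2 * u) ^ (-s) := by
        rw [Real.mul_rpow (by norm_num) hu.le, ← mul_assoc, ← Real.rpow_add (by norm_num)]
        simp
    _ ≤ 2 ^ s * w ^ (-s) := by
        gcongr 2 ^ s * ?_
        exact Real.rpow_le_rpow_of_nonpos hw h (by linarith)

/-- The part of the boundary layer of width `2 * ε` which lies in a ball satisfying the uniform cone
condition. -/
lemma setLIntegral_boundaryLayer_inter_ball_le {d : ℕ} (hd : 0 < d)
    {D : Set (EuclideanSpace ℝ (Fin d))} (hD : IsOpen D) (hne : (frontier D).Nonempty)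
    {r h : ℝ} (hr : 0 < r) {p v : EuclideanSpace ℝ (Fin d)} (hv : ‖v‖ = 1)
    (hcone : ∀ x ∈ ball p r ∩ closure D, ∀ t ∈ Ioc (0 : ℝ) h, ∀ y ∈ ball (x + t • v) (r * t), y ∈ D)
    {α : ℝ} (hα : 0 < α) {ε c₀ : ℝ} (hε : 0 < ε) (hc₀ : 0 < c₀) {x : EuclideanSpace ℝ (Fin d)}
    (hx : 4 * ε < infDist x (frontier D)) (hc₀h : c₀ * infDist x (frontier D) ≤ h)
    (hc₀4 : c₀ ≤ 1 / 4) :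
    ∫⁻ z in {z | x + z ∈ D ∧ infDist (x + z) (frontier D) ≤ 2 * ε ∧ x + z ∈ ball p r},
        ENNReal.ofReal (‖z‖ ^ (-((d : ℝ) + α)))
      ≤ ENNReal.ofReal (2 ^ ((d : ℝ) + α) *
          (polarConst (volume : Measure (EuclideanSpace ℝ (Fin d))) / α * 8 ^ α) *
          (4 / (c₀ * r)) * (ε * infDist x (frontier D) ^ (-1 - α))) := by
  have : Nonempty (Fin d) := ⟨⟨0, hd⟩⟩
  set δ := infDist x (frontier D) with hδ
  have hδ0 : 0 < δ := by linarith
  set T := c₀ * δ with hT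
  have hT0 : 0 < T := by positivity
  have hT4 : T ≤ δ / 4 := by rw [hT]; nlinarith
  set A := {z | x + z ∈ D ∧ infDist (x + z) (frontier D) ≤ 2 * ε ∧ x + z ∈ ball p r} with hA
  set N := ⌊T * r / (4 * ε)⌋₊ + 1 with hN
  set t : ℕ → EuclideanSpace ℝ (Fin d) := fun j => (j * (4 * ε / r)) • v with ht
  have htT : ∀ j < N, (j : ℝ) * (4 * ε / r) ≤ T := by
    intro j hj
    have h1 : (j : ℝ) ≤ T * r / (4 * ε) :=
      (Nat.le_floor_iff (by positivity)).1 (Nat.lt_succ_iff.1 hj)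
    calc (j : ℝ) * (4 * ε / r) ≤ T * r / (4 * ε) * (4 * ε / r) := by gcongr
      _ = T := by field_simp
  have htn : ∀ j < N, ‖t j‖ ≤ δ / 4 := by
    intro j hj
    rw [ht, norm_smul, hv, mul_one, Real.norm_of_nonneg (by positivity)]
    exact (htT j hj).trans hT4
  have hAδ : ∀ a ∈ A, δ / 2 ≤ ‖a‖ := by
    intro a ha
    have h1 : infDist x (frontier D) ≤ infDist (x + a) (frontier D) + dist x (x + a) :=
      infDist_le_infDist_add_dist
    rw [dist_self_add_right] at h1
    linarith [ha.2.1]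
  have hAm : MeasurableSet A := by
    have hc : Continuous fun z : EuclideanSpace ℝ (Fin d) => x + z := by fun_prop
    have h1 : MeasurableSet {z | x + z ∈ D} := (hD.preimage hc).measurableSet
    have h2 : MeasurableSet {z | infDist (x + z) (frontier D) ≤ 2 * ε} :=
      measurableSet_le ((continuous_infDist_pt _).comp hc).measurable measurable_const
    have h3 : MeasurableSet {z | x + z ∈ ball p r} := (isOpen_ball.preimage hc).measurableSet
    exact h1.inter (h2.inter h3)
  have hGm : Measurable fun z : EuclideanSpace ℝ (Fin d) =>
      ENNReal.ofReal (‖z‖ ^ (-((d : ℝ) + α))) := by fun_prop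
  have hmain := card_mul_setLIntegral_le_of_disjoint_translates
    (volume : Measure (EuclideanSpace ℝ (Fin d))) (U := {z | δ / 8 < ‖z‖}) hAm hGm N t
    (ENNReal.ofReal (2 ^ ((d : ℝ) + α))) ?_ ?_ ?_
  · obtain ⟨hint, hval⟩ := integrable_rpow_norm_tail
      (volume : Measure (EuclideanSpace ℝ (Fin d))) hα (ρ := δ / 8) (by positivity)
    rw [finrank_euclideanSpace_fin, ← neg_add] at hint hval
    rw [← ofReal_integral_eq_lintegral_ofReal hint (ae_of_all _ fun z => by positivity), hval,
      ← ENNReal.ofReal_mul (by positivity)] at hmain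
    have hNle : ENNReal.ofReal (T * r / (4 * ε)) ≤ N := by
      rw [← ENNReal.ofReal_natCast]
      exact ENNReal.ofReal_le_ofReal (by rw [hN]; push_cast; exact (Nat.lt_floor_add_one _).le)
    have hpos : 0 < T * r / (4 * ε) := by positivity
    have hmain' := (mul_le_mul_left hNle _).trans hmain
    rw [mul_comm, ← ENNReal.le_div_iff_mul_le (by simp [hpos]) (by simp),
      ← ENNReal.ofReal_div_of_pos hpos] at hmain'
    refine hmain'.trans (ENNReal.ofReal_le_ofReal (le_of_eq ?_))
    have hδα : (δ / 8) ^ (-α) = 8 ^ α * δ ^ (-1 - α) * δ := by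
      rw [Real.div_rpow hδ0.le (by norm_num), Real.rpow_neg (by norm_num : (0 : ℝ) ≤ 8),
        div_inv_eq_mul, mul_comm, mul_assoc, ← Real.rpow_add_one hδ0.ne']
      congr 2
      ring
    rw [hδα, hT]
    field_simp
  · intro i hi j hj hij a ha b hb hab
    have hji : (1 : ℝ) ≤ (j : ℝ) - i := by
      have : (i : ℝ) + 1 ≤ j := by exact_mod_cast hij
      linarith
    set s := ((j : ℝ) - i) * (4 * ε / r) with hs
    have hs0 : 0 < s := by positivity
    have hsh : s ≤ h := by
      have h1 := htT j hj
      have h2 : 0 ≤ (i : ℝ) * (4 * ε / r) := by positivity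
      have h3 : s = (j : ℝ) * (4 * ε / r) - (i : ℝ) * (4 * ε / r) := by rw [hs]; ring
      linarith
    have hxa : x + a = x + b + s • v := by
      have h1 : a = b + t j - t i := by rw [← hab]; abel
      rw [h1, hs, sub_mul, sub_smul]
      simp only [ht]
      abel
    have hsub : ball (x + a) (r * s) ⊆ D := by
      rw [hxa]
      exact fun y hy => hcone _ ⟨hb.2.2, subset_closure hb.1⟩ s ⟨hs0, hsh⟩ y hy
    have h1 := le_infDist_frontier_of_ball_subset hD hne hsub
    have h2 : 4 * ε ≤ r * s := by
      have : r * s = ((j : ℝ) - i) * (4 * ε) := by rw [hs]; field_simp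
      rw [this]
      nlinarith
    linarith [ha.2.1]
  · intro j hj a ha
    have h1 := norm_le_add_norm_add a (t j)
    change δ / 8 < ‖a + t j‖
    linarith [htn j hj, hAδ a ha]
  · intro j hj a ha
    rw [← ENNReal.ofReal_mul (by positivity)]
    have h1 := norm_le_add_norm_add a (t j)
    have h2 := norm_add_le a (t j)
    refine ENNReal.ofReal_le_ofReal (rpow_neg_le_two_rpow_mul (by positivity) ?_ ?_) <;>
    linarith [htn j hj, hAδ a ha]

lemma frontier_nonempty_of_isBounded {E : Type*} [NormedAddCommGroup E] [NormedSpace ℝ E]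
    [Nontrivial E] {D : Set E} (hD : Bornology.IsBounded D) (hne : D.Nonempty) :
    (frontier D).Nonempty := by
  refine nonempty_frontier_iff.2 ⟨hne, ?_⟩
  rintro rfl
  exact NormedSpace.unbounded_univ ℝ E hD

lemma exists_infDist_frontier_le {X : Type*} [PseudoMetricSpace X] {D : Set X}
    (hD : Bornology.IsBounded D) : ∃ Δ : ℝ, 0 < Δ ∧ ∀ x ∈ D, infDist x (frontier D) ≤ Δ := by
  refine ⟨diam (closure D) + 1, by positivity, fun x hx => ?_⟩
  rcases (frontier D).eq_empty_or_nonempty with h | ⟨p, hp⟩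
  · rw [h, infDist_empty]
    positivity
  · have h1 := dist_le_diam_of_mem hD.closure (subset_closure hx) (frontier_subset_closure hp)
    linarith [infDist_le_dist_of_mem (x := x) hp]

/-- Quantitative smallness of the boundary layer of width `2 * ε`, as seen by the kernel of the
fractional Laplacian from a point far away from the layer. -/
lemma exists_setLIntegral_boundaryLayer_le {d : ℕ} (hd : 0 < d)
    {D : Set (EuclideanSpace ℝ (Fin d))} (hD : IsBoundedLipschitzDomain D) (hDne : D.Nonempty)
    {α : ℝ} (hα : 0 < α) :
    ∃ C : ℝ, 0 ≤ C ∧ ∀ ε : ℝ, 0 < ε → ∀ x ∈ D, 4 * ε < infDist x (frontier D) →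
      ∫⁻ z in {z | x + z ∈ D ∧ infDist (x + z) (frontier D) ≤ 2 * ε},
        ENNReal.ofReal (‖z‖ ^ (-((d : ℝ) + α)))
      ≤ ENNReal.ofReal (C * (ε * infDist x (frontier D) ^ (-1 - α))) := by
  have : Nonempty (Fin d) := ⟨⟨0, hd⟩⟩
  obtain ⟨hDo, hDb, r, h, hr, hh, hcone⟩ := hD
  have hne := frontier_nonempty_of_isBounded hDb hDne
  obtain ⟨Δ, hΔ, hδΔ⟩ := exists_infDist_frontier_le hDb
  have hcpt : IsCompact (frontier D) :=
    Metric.isCompact_of_isClosed_isBounded isClosed_frontier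
      (hDb.closure.subset frontier_subset_closure)
  obtain ⟨S, hSf, hSfin, hS⟩ := hcpt.finite_cover_balls (half_pos hr)
  set V := polarConst (volume : Measure (EuclideanSpace ℝ (Fin d))) with hV
  have hV0 : 0 ≤ V := polarConst_nonneg _
  set c₀ := min (h / Δ) (1 / 4) with hc₀
  have hc₀0 : 0 < c₀ := lt_min (by positivity) (by norm_num)
  set C₁ := 2 ^ ((d : ℝ) + α) * (V / α * 8 ^ α) * (4 / (c₀ * r)) with hC₁
  set C₂ := V / α * 8 ^ α * (Δ * (4 / r)) with hC₂
  have hC₁0 : 0 ≤ C₁ := by positivity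
  have hC₂0 : 0 ≤ C₂ := by positivity
  have := hSfin.fintype
  refine ⟨Fintype.card S * C₁ + C₂, by positivity, fun ε hε x hx hxε => ?_⟩
  set δ := infDist x (frontier D) with hδ
  have hδ0 : 0 < δ := by linarith
  have hX0 : 0 ≤ ε * δ ^ (-1 - α) := by positivity
  rcases lt_or_ge ε (r / 4) with hεr | hεr
  · have hsub : {z | x + z ∈ D ∧ infDist (x + z) (frontier D) ≤ 2 * ε} ⊆
        ⋃ p : S, {z | x + z ∈ D ∧ infDist (x + z) (frontier D) ≤ 2 * ε ∧ x + z ∈ ball p.1 r} := by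
      rintro z ⟨hzD, hzε⟩
      obtain ⟨q, hq, hzq⟩ := (infDist_lt_iff hne).1 (lt_of_le_of_lt hzε (by linarith : _ < r / 2))
      obtain ⟨p, hp, hqp⟩ := mem_iUnion₂.1 (hS hq)
      refine mem_iUnion.2 ⟨⟨p, hp⟩, hzD, hzε, ?_⟩
      rw [mem_ball] at hqp ⊢
      linarith [dist_triangle (x + z) q p]
    refine (lintegral_mono_set hsub).trans ((lintegral_iUnion_le _ _).trans ?_)
    rw [tsum_fintype]
    calc _ ≤ ∑ _p : S, ENNReal.ofReal (C₁ * (ε * δ ^ (-1 - α))) := by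
          refine Finset.sum_le_sum fun p _ => ?_
          obtain ⟨v, hv, hcv⟩ := hcone p (hSf p.2)
          refine setLIntegral_boundaryLayer_inter_ball_le hd hDo hne hr hv hcv hα hε hc₀0 hxε ?_
            (min_le_right _ _)
          calc c₀ * δ ≤ h / Δ * Δ :=
                mul_le_mul (min_le_left _ _) (hδΔ x hx) hδ0.le (by positivity)
            _ = h := by field_simp
      _ = ENNReal.ofReal (Fintype.card S * C₁ * (ε * δ ^ (-1 - α))) := by
          rw [Finset.sum_const, nsmul_eq_mul, Finset.card_univ, mul_assoc (Fintype.card S : ℝ),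
            ENNReal.ofReal_mul (Nat.cast_nonneg _), ENNReal.ofReal_natCast]
      _ ≤ _ := ENNReal.ofReal_le_ofReal (by nlinarith)
  · have hsub : {z | x + z ∈ D ∧ infDist (x + z) (frontier D) ≤ 2 * ε} ⊆ {z | δ / 8 < ‖z‖} := by
      rintro z ⟨-, hzε⟩
      have h1 : infDist x (frontier D) ≤ infDist (x + z) (frontier D) + dist x (x + z) :=
        infDist_le_infDist_add_dist
      rw [dist_self_add_right] at h1
      change δ / 8 < ‖z‖
      linarith
    obtain ⟨hint, hval⟩ := integrable_rpow_norm_tail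
      (volume : Measure (EuclideanSpace ℝ (Fin d))) hα (ρ := δ / 8) (by positivity)
    rw [finrank_euclideanSpace_fin, ← neg_add] at hint hval
    refine (lintegral_mono_set hsub).trans ?_
    rw [← ofReal_integral_eq_lintegral_ofReal hint (ae_of_all _ fun z => by positivity), hval]
    refine ENNReal.ofReal_le_ofReal ?_
    have hδα : (δ / 8) ^ (-α) = 8 ^ α * δ ^ (-1 - α) * δ := by
      rw [Real.div_rpow hδ0.le (by norm_num), Real.rpow_neg (by norm_num : (0 : ℝ) ≤ 8),
        div_inv_eq_mul, mul_comm, mul_assoc, ← Real.rpow_add_one hδ0.ne']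
      congr 2
      ring
    have h1 : δ ≤ Δ * (4 / r) * ε := by
      have h2 : 1 ≤ 4 / r * ε := by
        rw [div_mul_eq_mul_div, le_div_iff₀ hr]
        linarith
      nlinarith [hδΔ x hx]
    calc V / α * (δ / 8) ^ (-α) = V / α * 8 ^ α * δ ^ (-1 - α) * δ := by rw [hδα]; ring
      _ ≤ V / α * 8 ^ α * δ ^ (-1 - α) * (Δ * (4 / r) * ε) := by gcongr
      _ = C₂ * (ε * δ ^ (-1 - α)) := by rw [hC₂]; ring
      _ ≤ _ := by
          have : 0 ≤ Fintype.card S * C₁ * (ε * δ ^ (-1 - α)) := by positivity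
          linarith

/-- Functions with `|f| ≤ M δ ^ s` and `‖∇ f‖ ≤ M δ ^ (s - 1)`, `δ` being the distance to the
boundary, are `s`-Hölder up to the boundary after extension by zero. -/
lemma abs_sub_le_rpow_norm_of_fderiv_le {E : Type*} [NormedAddCommGroup E] [NormedSpace ℝ E]
    {D : Set E} (hD : IsOpen D) {f : E → ℝ} {M s : ℝ} (hM : 0 ≤ M) (hs0 : 0 < s) (hs1 : s < 1)
    (hf0 : ∀ x ∉ D, f x = 0) (hfd : ∀ x ∈ D, DifferentiableAt ℝ f x)
    (hf : ∀ x ∈ D, |f x| ≤ M * infDist x (frontier D) ^ s)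
    (hf' : ∀ x ∈ D, ‖fderiv ℝ f x‖ ≤ M * infDist x (frontier D) ^ (-1 + s))
    {x : E} (hx : x ∈ D) (z : E) : |f (x + z) - f x| ≤ 6 * M * ‖z‖ ^ s := by
  rcases eq_or_ne z 0 with rfl | hz
  · simp only [add_zero, sub_self, abs_zero]
    positivity
  have hz0 : 0 < ‖z‖ := norm_pos_iff.2 hz
  set δ := infDist x (frontier D) with hδ
  have hδ0 : 0 ≤ δ := infDist_nonneg
  rcases le_or_gt δ (2 * ‖z‖) with h | h
  · have h3 : (3 * ‖z‖) ^ s ≤ 3 * ‖z‖ ^ s := by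
      rw [Real.mul_rpow (by norm_num) hz0.le]
      gcongr
      calc (3 : ℝ) ^ s ≤ 3 ^ (1 : ℝ) := Real.rpow_le_rpow_of_exponent_le (by norm_num) hs1.le
        _ = 3 := Real.rpow_one 3
    have hfx : |f x| ≤ M * (3 * ‖z‖ ^ s) := by
      refine (hf x hx).trans ?_
      gcongr
      exact (Real.rpow_le_rpow hδ0 (by linarith) hs0.le).trans h3
    have hfy : |f (x + z)| ≤ M * (3 * ‖z‖ ^ s) := by
      by_cases hy : x + z ∈ D
      · refine (hf _ hy).trans ?_
        gcongr
        refine (Real.rpow_le_rpow infDist_nonneg ?_ hs0.le).trans h3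
        have h1 : infDist (x + z) (frontier D) ≤ infDist x (frontier D) + dist (x + z) x :=
          infDist_le_infDist_add_dist
        rw [dist_self_add_left] at h1
        linarith
      · rw [hf0 _ hy, abs_zero]
        positivity
    linarith [abs_sub (f (x + z)) (f x)]
  · have hball : ∀ y ∈ closedBall x ‖z‖, y ∈ D ∧ ‖z‖ ≤ infDist y (frontier D) := by
      intro y hy
      rw [mem_closedBall] at hy
      have h1 : infDist x (frontier D) ≤ infDist y (frontier D) + dist x y :=
        infDist_le_infDist_add_dist
      rw [dist_comm] at h1
      refine ⟨?_, by linarith⟩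
      by_contra hyD
      have := infDist_frontier_le_dist hD hx hyD
      rw [dist_comm] at this
      linarith
    have hmv := (convex_closedBall x ‖z‖).norm_image_sub_le_of_norm_fderiv_le (f := f) (𝕜 := ℝ)
      (C := M * ‖z‖ ^ (-1 + s)) (x := x) (y := x + z) (fun y hy => hfd y (hball y hy).1)
      (fun y hy => (hf' y (hball y hy).1).trans (by
        gcongr M * ?_
        exact Real.rpow_le_rpow_of_nonpos hz0 (hball y hy).2 (by linarith)))
      (mem_closedBall_self hz0.le) (by simp)
    rw [add_sub_cancel_left, Real.norm_eq_abs, mul_assoc, ← Real.rpow_add_one hz0.ne'] at hmv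
    rw [show -1 + s + 1 = s by ring] at hmv
    have : 0 ≤ M * ‖z‖ ^ s := by positivity
    linarith

lemma norm_second_difference_le {E : Type*} [NormedAddCommGroup E] [NormedSpace ℝ E]
    {g : E → ℝ} (hg : ContDiff ℝ 2 g) {L : ℝ} (hL : ∀ x, ‖fderiv ℝ (fderiv ℝ g) x‖ ≤ L) (x z : E) :
    |g (x + z) + g (x - z) - 2 * g x| ≤ 2 * L * ‖z‖ ^ 2 := by
  have hL0 : 0 ≤ L := le_trans (norm_nonneg (fderiv ℝ (fderiv ℝ g) x)) (hL x)
  have hgd : Differentiable ℝ g := hg.differentiable (by norm_num)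
  have hg'd : Differentiable ℝ (fderiv ℝ g) :=
    (hg.fderiv_right (m := 1) (by norm_num)).differentiable (by norm_num)
  have hlip : ∀ u v, ‖fderiv ℝ g u - fderiv ℝ g v‖ ≤ L * ‖u - v‖ := fun u v =>
    convex_univ.norm_image_sub_le_of_norm_fderiv_le (𝕜 := ℝ) (fun y _ => hg'd y) (fun y _ => hL y)
      (mem_univ v) (mem_univ u)
  have hder : ∀ w, HasFDerivAt (fun w => g (x + w) + g (x - w))
      (fderiv ℝ g (x + w) - fderiv ℝ g (x - w)) w := by
    intro w
    have h1 := (hgd (x + w)).hasFDerivAt.comp w ((hasFDerivAt_id w).const_add x)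
    have h2 := (hgd (x - w)).hasFDerivAt.comp w ((hasFDerivAt_id w).const_sub x)
    have h := h1.add h2
    rw [ContinuousLinearMap.comp_neg, ContinuousLinearMap.comp_id, ContinuousLinearMap.comp_id,
      ← sub_eq_add_neg] at h
    exact h
  have hmv := (convex_closedBall (0 : E) ‖z‖).norm_image_sub_le_of_norm_hasFDerivWithin_le
    (C := 2 * L * ‖z‖) (x := 0) (y := z) (fun w _ => (hder w).hasFDerivWithinAt)
    (fun w hw => (hlip _ _).trans (by
      rw [mem_closedBall_zero_iff] at hw
      have h1 : x + w - (x - w) = (2 : ℝ) • w := by rw [two_smul]; abel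
      rw [h1, norm_smul, Real.norm_two]
      nlinarith)) (by simp) (by simp)
  simp only [add_zero, sub_zero, Real.norm_eq_abs] at hmv
  calc _ = |g (x + z) + g (x - z) - (g x + g x)| := by ring_nf
    _ ≤ 2 * L * ‖z‖ * ‖z‖ := hmv
    _ = _ := by ring

section Kernel

variable {d : ℕ} {α : ℝ} (K : ℝ)

lemma integrableOn_mul_kernel (hd : 0 < d) (hα : 0 < α) {u : EuclideanSpace ℝ (Fin d) → ℝ}
    (hu : Measurable u) {B : ℝ} (hB : ∀ z, |u z| ≤ B) {ρ : ℝ} (hρ : 0 < ρ) :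
    IntegrableOn (fun z => u z * K * ‖z‖ ^ (-((d : ℝ) + α))) {z | ρ < ‖z‖} := by
  have : Nonempty (Fin d) := ⟨⟨0, hd⟩⟩
  have hint := (integrable_rpow_norm_tail
    (volume : Measure (EuclideanSpace ℝ (Fin d))) hα hρ).1
  rw [finrank_euclideanSpace_fin, ← neg_add] at hint
  refine Integrable.bdd_mul (c := B * |K|) hint (hu.mul_const K).aestronglyMeasurable
    (ae_of_all _ fun z => ?_)
  rw [Real.norm_eq_abs, abs_mul]
  exact mul_le_mul_of_nonneg_right (hB z) (abs_nonneg K)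

lemma abs_setIntegral_mul_kernel_le_of_support {u : EuclideanSpace ℝ (Fin d) → ℝ} {B X : ℝ}
    {A : Set (EuclideanSpace ℝ (Fin d))} (hB : 0 ≤ B) (hK : 0 ≤ K) (hX : 0 ≤ X)
    (hu : ∀ z, |u z| ≤ B) (hu0 : ∀ z ∉ A, u z = 0)
    (hA : ∫⁻ z in A, ENNReal.ofReal (‖z‖ ^ (-((d : ℝ) + α))) ≤ ENNReal.ofReal X)
    (S : Set (EuclideanSpace ℝ (Fin d))) :
    |∫ z in S, u z * K * ‖z‖ ^ (-((d : ℝ) + α))| ≤ B * K * X := by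
  have hGm : Measurable fun z : EuclideanSpace ℝ (Fin d) =>
      ENNReal.ofReal (‖z‖ ^ (-((d : ℝ) + α))) := by fun_prop
  have hpt : ∀ z, ‖u z * K * ‖z‖ ^ (-((d : ℝ) + α))‖ₑ ≤
      A.indicator
        (fun z => ENNReal.ofReal (B * K) * ENNReal.ofReal (‖z‖ ^ (-((d : ℝ) + α)))) z := by
    intro z
    by_cases hz : z ∈ A
    · rw [indicator_of_mem hz, ← ENNReal.ofReal_mul (by positivity), ← ofReal_norm]
      refine ENNReal.ofReal_le_ofReal ?_
      rw [norm_mul, norm_mul, Real.norm_eq_abs, Real.norm_of_nonneg hK,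
        Real.norm_of_nonneg (by positivity : 0 ≤ ‖z‖ ^ (-((d : ℝ) + α)))]
      gcongr
      exact hu z
    · simp [hu0 z hz]
  have hle : ‖∫ z in S, u z * K * ‖z‖ ^ (-((d : ℝ) + α))‖ₑ ≤ ENNReal.ofReal (B * K * X) :=
    calc _ ≤ ∫⁻ z in S, ‖u z * K * ‖z‖ ^ (-((d : ℝ) + α))‖ₑ := enorm_integral_le_lintegral_enorm _
      _ ≤ ∫⁻ z, ‖u z * K * ‖z‖ ^ (-((d : ℝ) + α))‖ₑ := setLIntegral_le_lintegral _ _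
      _ ≤ _ := lintegral_mono hpt
      _ ≤ _ := lintegral_indicator_le _ _
      _ = _ := lintegral_const_mul _ hGm
      _ ≤ ENNReal.ofReal (B * K) * ENNReal.ofReal X := by gcongr
      _ = _ := by rw [← ENNReal.ofReal_mul (by positivity)]
  rw [← ofReal_norm, ENNReal.ofReal_le_ofReal_iff (by positivity)] at hle
  exact hle

lemma abs_setIntegral_mul_kernel_le (hd : 0 < d) (hK : 0 ≤ K)
    {u : EuclideanSpace ℝ (Fin d) → ℝ} {P Q ρ σ τ : ℝ} (hP : 0 ≤ P) (hQ : 0 ≤ Q) (hρ : 0 < ρ)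
    (hσ0 : 0 < σ) (hσ : α < σ) (hτ : τ < α)
    (hnear : ∀ z, ‖z‖ ≤ ρ → |u z| ≤ P * ‖z‖ ^ σ) (hfar : ∀ z, ρ < ‖z‖ → |u z| ≤ Q * ‖z‖ ^ τ)
    (S : Set (EuclideanSpace ℝ (Fin d))) :
    |∫ z in S, u z * K * ‖z‖ ^ (-((d : ℝ) + α))| ≤
      polarConst (volume : Measure (EuclideanSpace ℝ (Fin d))) * K *
        (P / (σ - α) * ρ ^ (σ - α) + Q / (α - τ) * ρ ^ (τ - α)) := by
  have : Nonempty (Fin d) := ⟨⟨0, hd⟩⟩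
  have hgen : ∀ (z : EuclideanSpace ℝ (Fin d)) (R s : ℝ), 0 < ‖z‖ → |u z| ≤ R * ‖z‖ ^ s →
      ‖u z * K * ‖z‖ ^ (-((d : ℝ) + α))‖ ≤ R * K * ‖z‖ ^ (-(d : ℝ) + (s - α)) := by
    intro z R s hz h
    rw [norm_mul, norm_mul, Real.norm_eq_abs, Real.norm_of_nonneg hK,
      Real.norm_of_nonneg (by positivity : 0 ≤ ‖z‖ ^ (-((d : ℝ) + α)))]
    calc |u z| * K * ‖z‖ ^ (-((d : ℝ) + α)) ≤ R * ‖z‖ ^ s * K * ‖z‖ ^ (-((d : ℝ) + α)) := by gcongr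
      _ = R * K * (‖z‖ ^ s * ‖z‖ ^ (-((d : ℝ) + α))) := by ring
      _ = _ := by
        rw [← Real.rpow_add hz]
        congr 2
        ring
  have hmain := norm_setIntegral_le_of_norm_le_rpow
    (volume : Measure (EuclideanSpace ℝ (Fin d))) (p := σ - α) (q := α - τ) (ρ := ρ)
    (P := P * K) (Q := Q * K) (F := fun z => u z * K * ‖z‖ ^ (-((d : ℝ) + α)))
    (by linarith) (by linarith) hρ (by positivity) (by positivity) S ?_ ?_
  · refine hmain.trans (le_of_eq ?_)
    rw [neg_sub]
    ring
  · intro z hz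
    rw [finrank_euclideanSpace_fin]
    rcases eq_or_ne z 0 with rfl | hz0
    · have h1 := hnear 0 hz
      rw [norm_zero, Real.zero_rpow hσ0.ne', mul_zero] at h1
      rw [abs_nonpos_iff.1 h1, zero_mul, zero_mul, norm_zero]
      positivity
    · exact hgen z P σ (norm_pos_iff.2 hz0) (hnear z hz)
  · intro z hz
    rw [finrank_euclideanSpace_fin, neg_sub]
    exact hgen z Q τ (hρ.trans hz) (hfar z hz)

lemma abs_setIntegral_sub_mul_kernel_le (hd : 0 < d) (hα : α ∈ Ioo (0 : ℝ) 2) (hK : 0 ≤ K)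
    {g : EuclideanSpace ℝ (Fin d) → ℝ} (hg : ContDiff ℝ 2 g) (hg01 : ∀ x, g x ∈ Icc (0 : ℝ) 1)
    {L ρ : ℝ} (hL : ∀ x, ‖fderiv ℝ (fderiv ℝ g) x‖ ≤ L) (hρ : 0 < ρ)
    (x : EuclideanSpace ℝ (Fin d)) {r : ℝ} (hr : 0 < r) :
    |∫ z in {z | r < ‖z‖}, (g (x + z) - g x) * K * ‖z‖ ^ (-((d : ℝ) + α))| ≤
      polarConst (volume : Measure (EuclideanSpace ℝ (Fin d))) * K *
        (L / (2 - α) * ρ ^ (2 - α) + 1 / α * ρ ^ (-α)) := by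
  have hL0 : 0 ≤ L := le_trans (norm_nonneg (fderiv ℝ (fderiv ℝ g) x)) (hL x)
  have hS : MeasurableSet {z : EuclideanSpace ℝ (Fin d) | r < ‖z‖} :=
    measurableSet_lt measurable_const measurable_norm
  have hgm : Measurable g := hg.continuous.measurable
  have hbd : ∀ y, |g y - g x| ≤ 1 := fun y => by
    rw [abs_le]
    constructor <;> linarith [(hg01 y).1, (hg01 y).2, (hg01 x).1, (hg01 x).2]
  have hi1 := integrableOn_mul_kernel K hd hα.1 (u := fun z => g (x + z) - g x)
    (by fun_prop) (fun z => hbd _) hr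
  have hi2 := integrableOn_mul_kernel K hd hα.1 (u := fun z => g (x - z) - g x)
    (by fun_prop) (fun z => hbd _) hr
  have hrefl : ∫ z in {z | r < ‖z‖}, (g (x - z) - g x) * K * ‖z‖ ^ (-((d : ℝ) + α))
      = ∫ z in {z | r < ‖z‖}, (g (x + z) - g x) * K * ‖z‖ ^ (-((d : ℝ) + α)) := by
    rw [← integral_indicator hS, ← integral_indicator hS, ← integral_neg_eq_self]
    congr 1
    ext z
    simp [indicator]
  have hsum : 2 * ∫ z in {z | r < ‖z‖}, (g (x + z) - g x) * K * ‖z‖ ^ (-((d : ℝ) + α))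
      = ∫ z in {z | r < ‖z‖},
          (g (x + z) + g (x - z) - 2 * g x) * K * ‖z‖ ^ (-((d : ℝ) + α)) := by
    rw [two_mul]
    nth_rewrite 2 [← hrefl]
    rw [← integral_add hi1 hi2]
    congr 1
    ext z
    ring
  have hmain := abs_setIntegral_mul_kernel_le K hd hK (α := α) (P := 2 * L) (Q := 2) (σ := 2)
    (τ := 0) (ρ := ρ) (u := fun z => g (x + z) + g (x - z) - 2 * g x)
    (by positivity) (by norm_num) hρ (by norm_num) hα.2 hα.1
    (fun z _ => by simpa using norm_second_difference_le hg hL x z)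
    (fun z _ => by
      rw [Real.rpow_zero, mul_one, abs_le]
      constructor <;> linarith [(hg01 (x + z)).1, (hg01 (x + z)).2, (hg01 (x - z)).1,
        (hg01 (x - z)).2, (hg01 x).1, (hg01 x).2])
    {z | r < ‖z‖}
  rw [← hsum, abs_mul, abs_two, zero_sub, sub_zero] at hmain
  have heq : polarConst (volume : Measure (EuclideanSpace ℝ (Fin d))) * K *
      (2 * L / (2 - α) * ρ ^ (2 - α) + 2 / α * ρ ^ (-α)) =
      2 * (polarConst (volume : Measure (EuclideanSpace ℝ (Fin d))) * K *
        (L / (2 - α) * ρ ^ (2 - α) + 1 / α * ρ ^ (-α))) := by ring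
  linarith

end Kernel

theorem stmt_13 {d : ℕ} (hd : 0 < d) {D : Set (EuclideanSpace ℝ (Fin d))}
    (hD : IsBoundedLipschitzDomain D) {α : ℝ} (hα : α ∈ Set.Ioo (0 : ℝ) 2)
    (Kbar : ℝ) (hKbar : 0 < Kbar)
    (M : ℝ) (hM : 0 ≤ M) (f : EuclideanSpace ℝ (Fin d) → ℝ)
    -- f ∈ C^3_{(-α/2)}(D)
    (hf0 : ∀ x ∉ D, f x = 0)
    (hfC : ContDiffOn ℝ 3 f D)
    (hfb : ∀ x ∈ D, ∀ k : ℕ, k ≤ 3 →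
        ‖iteratedFDerivWithin ℝ k f D x‖
          ≤ M * Metric.infDist x (frontier D) ^ (-(k : ℝ) + α / 2))
    -- the family of cut-off functions
    (η : ℝ → EuclideanSpace ℝ (Fin d) → ℝ) (c : ℝ)
    (hηsmooth : ∀ ε ∈ Set.Ioo (0 : ℝ) 1, ContDiff ℝ (⊤ : ℕ∞) (η ε))
    (hη01 : ∀ ε ∈ Set.Ioo (0 : ℝ) 1, ∀ x, η ε x ∈ Set.Icc (0 : ℝ) 1)
    (hηone : ∀ ε ∈ Set.Ioo (0 : ℝ) 1, ∀ x ∈ D,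
        2 * ε < Metric.infDist x (frontier D) → η ε x = 1)
    (hηzero : ∀ ε ∈ Set.Ioo (0 : ℝ) 1, ∀ x,
        (x ∉ D ∨ Metric.infDist x (frontier D) ≤ ε) → η ε x = 0)
    (hηderiv : ∀ ε ∈ Set.Ioo (0 : ℝ) 1, ∀ k : ℕ, 1 ≤ k → k ≤ 3 → ∀ x,
        ‖iteratedFDeriv ℝ k (η ε) x‖ ≤ c * ε ^ (-(k : ℝ)) *
          Set.indicator {y : EuclideanSpace ℝ (Fin d) |
              ε < Metric.infDist y (frontier D) ∧
                Metric.infDist y (frontier D) ≤ 2 * ε}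
            (fun _ => (1 : ℝ)) x) :
    ∃ C : ℝ, 0 < C ∧
      ∀ ε ∈ Set.Ioo (0 : ℝ) 1, ∀ x ∈ D, ∀ a b : ℝ,
        -- `a` is the principal value `L̄ f_ε (x)`, where `f_ε := f · η_ε`,
        Filter.Tendsto
          (fun r : ℝ => ∫ z in {z : EuclideanSpace ℝ (Fin d) | r < ‖z‖},
            (f (x + z) * η ε (x + z) - f x * η ε x) * Kbar * ‖z‖ ^ (-((d : ℝ) + α)))
          (nhdsWithin 0 (Set.Ioi 0)) (nhds a) →
        -- `b` is the principal value `L̄ f (x)`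
        Filter.Tendsto
          (fun r : ℝ => ∫ z in {z : EuclideanSpace ℝ (Fin d) | r < ‖z‖},
            (f (x + z) - f x) * Kbar * ‖z‖ ^ (-((d : ℝ) + α)))
          (nhdsWithin 0 (Set.Ioi 0)) (nhds b) →
        |a - η ε x * b|
          ≤ C * (Set.indicator {y : EuclideanSpace ℝ (Fin d) |
                4 * ε < Metric.infDist y (frontier D)}
              (fun _ => ε * Metric.infDist x (frontier D) ^ (-1 - α / 2)) x
            + Set.indicator {y : EuclideanSpace ℝ (Fin d) |
                Metric.infDist y (frontier D) ≤ 4 * ε}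
              (fun _ => ε ^ (-(α / 2))) x) := by
  have : Nonempty (Fin d) := ⟨⟨0, hd⟩⟩
  obtain ⟨hα0, hα2⟩ := hα
  rcases D.eq_empty_or_nonempty with rfl | hDne
  · exact ⟨1, one_pos, fun ε _ x hx => absurd hx (notMem_empty x)⟩
  have hDo : IsOpen D := hD.1
  obtain ⟨Δ, hΔ, hδΔ⟩ := exists_infDist_frontier_le hD.2.1
  obtain ⟨C₁, hC₁, hlayer⟩ := exists_setLIntegral_boundaryLayer_le hd hD hDne hα0
  have hfb0 : ∀ x ∈ D, |f x| ≤ M * infDist x (frontier D) ^ (α / 2) := by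
    intro x hx
    have h := hfb x hx 0 (by norm_num)
    rwa [norm_iteratedFDerivWithin_zero, Nat.cast_zero, neg_zero, zero_add, Real.norm_eq_abs] at h
  have hfb1 : ∀ x ∈ D, ‖fderiv ℝ f x‖ ≤ M * infDist x (frontier D) ^ (-1 + α / 2) := by
    intro x hx
    have h := hfb x hx 1 (by norm_num)
    rwa [norm_iteratedFDerivWithin_one f (hDo.uniqueDiffWithinAt hx),
      fderivWithin_of_isOpen hDo hx, Nat.cast_one] at h
  have hfd : ∀ x ∈ D, DifferentiableAt ℝ f x := fun x hx =>
    (hfC.differentiableOn (by norm_num)).differentiableAt (hDo.mem_nhds hx)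
  have hhol : ∀ x ∈ D, ∀ z, |f (x + z) - f x| ≤ 6 * M * ‖z‖ ^ (α / 2) := fun x hx z =>
    abs_sub_le_rpow_norm_of_fderiv_le hDo hM (by linarith) (by linarith) hf0 hfd hfb0 hfb1 hx z
  have hfm : Measurable f := by
    classical
    have h : D.piecewise f 0 = f := by
      ext y
      by_cases hy : y ∈ D
      · simp [hy]
      · simp [hy, hf0 y hy]
    rw [← h]
    exact hfC.continuousOn.measurable_piecewise continuousOn_const hDo.measurableSet
  have hfB : ∀ y, |f y| ≤ M * Δ ^ (α / 2) := by
    intro y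
    by_cases hy : y ∈ D
    · refine (hfb0 y hy).trans ?_
      exact mul_le_mul_of_nonneg_left
        (Real.rpow_le_rpow infDist_nonneg (hδΔ y hy) (by linarith)) hM
    · rw [hf0 y hy, abs_zero]
      positivity
  have hη1 : ∀ ε ∈ Ioo (0 : ℝ) 1, ∀ k : ℕ, 1 ≤ k → k ≤ 3 → ∀ x,
      ‖iteratedFDeriv ℝ k (η ε) x‖ ≤ |c| * ε ^ (-(k : ℝ)) := by
    intro ε hε k hk1 hk3 x
    have hεk : 0 ≤ ε ^ (-(k : ℝ)) := Real.rpow_nonneg hε.1.le _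
    refine (hηderiv ε hε k hk1 hk3 x).trans ?_
    unfold indicator
    split_ifs
    · rw [mul_one]
      exact mul_le_mul_of_nonneg_right (le_abs_self c) hεk
    · rw [mul_zero]
      positivity
  set V := polarConst (volume : Measure (EuclideanSpace ℝ (Fin d))) with hV
  have hV0 : 0 ≤ V := polarConst_nonneg _
  set CΓ := V * Kbar * (6 * M * |c| / (1 + α / 2 - α) + 6 * M / (α - α / 2)) with hCΓ
  set CL := 4 * M * (V * Kbar * (|c| / (2 - α) + 1 / α)) with hCL
  set CB := M * Kbar * C₁ with hCB
  have hden1 : 0 < 1 + α / 2 - α := by linarith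
  have hden2 : 0 < α - α / 2 := by linarith
  have hden3 : 0 < 2 - α := by linarith
  have hCΓ0 : 0 ≤ CΓ := by positivity
  have hCL0 : 0 ≤ CL := by positivity
  have hCB0 : 0 ≤ CB := by positivity
  refine ⟨CΓ + CL + CB + 1, by positivity, fun ε hε x hx a b ha hb => ?_⟩
  have hε0 : 0 < ε := hε.1
  set δ := infDist x (frontier D) with hδ
  have hδ0 : 0 ≤ δ := infDist_nonneg
  have hηc : ContDiff ℝ 2 (η ε) := contDiff_infty.1 (hηsmooth ε hε) 2
  have hηm : Measurable (η ε) := hηc.continuous.measurable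
  have hηdiff : ∀ y, |η ε y - η ε x| ≤ 1 := fun y => by
    rw [abs_le]
    constructor <;> linarith [(hη01 ε hε y).1, (hη01 ε hε y).2, (hη01 ε hε x).1, (hη01 ε hε x).2]
  have hηabs : ∀ y, |η ε y| ≤ 1 := fun y => by
    rw [abs_of_nonneg (hη01 ε hε y).1]
    exact (hη01 ε hε y).2
  set B := M * Δ ^ (α / 2) with hB
  have hB0 : 0 ≤ B := by positivity
  have hfηB : ∀ y, |f y * η ε y| ≤ B := fun y => by
    rw [abs_mul]
    exact (mul_le_mul (hfB y) (hηabs y) (abs_nonneg _) hB0).trans (mul_one B).le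
  have hcomb : ∀ r ∈ Ioi (0 : ℝ),
      (∫ z in {z : EuclideanSpace ℝ (Fin d) | r < ‖z‖},
        (f (x + z) * η ε (x + z) - f x * η ε x) * Kbar * ‖z‖ ^ (-((d : ℝ) + α))) -
      η ε x * (∫ z in {z : EuclideanSpace ℝ (Fin d) | r < ‖z‖},
        (f (x + z) - f x) * Kbar * ‖z‖ ^ (-((d : ℝ) + α))) =
      ∫ z in {z : EuclideanSpace ℝ (Fin d) | r < ‖z‖},
        f (x + z) * (η ε (x + z) - η ε x) * Kbar * ‖z‖ ^ (-((d : ℝ) + α)) := by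
    intro r hr
    have hi1 := integrableOn_mul_kernel Kbar hd hα0
      (u := fun z => f (x + z) * η ε (x + z) - f x * η ε x) (B := B + B) (by fun_prop)
      (fun z => (abs_sub _ _).trans (add_le_add (hfηB _) (hfηB _))) hr
    have hi2 := integrableOn_mul_kernel Kbar hd hα0
      (u := fun z => f (x + z) - f x) (B := B + B) (by fun_prop)
      (fun z => (abs_sub _ _).trans (add_le_add (hfB _) (hfB _))) hr
    rw [← integral_const_mul, ← integral_sub hi1 (hi2.const_mul _)]
    congr 1
    ext z
    ring
  suffices hbound : ∀ r ∈ Ioi (0 : ℝ), |∫ z in {z : EuclideanSpace ℝ (Fin d) | r < ‖z‖},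
      f (x + z) * (η ε (x + z) - η ε x) * Kbar * ‖z‖ ^ (-((d : ℝ) + α))| ≤
      (CΓ + CL + CB + 1) * (indicator {y : EuclideanSpace ℝ (Fin d) |
                4 * ε < infDist y (frontier D)} (fun _ => ε * δ ^ (-1 - α / 2)) x
            + indicator {y : EuclideanSpace ℝ (Fin d) |
                infDist y (frontier D) ≤ 4 * ε} (fun _ => ε ^ (-(α / 2))) x) by
    refine le_of_tendsto (ha.sub (hb.const_mul (η ε x))).abs ?_
    filter_upwards [self_mem_nhdsWithin] with r hr
    rw [hcomb r hr]
    exact hbound r hr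
  intro r hr
  rcases lt_or_ge (4 * ε) δ with hcase | hcase
  · rw [indicator_of_mem (s := {y | 4 * ε < infDist y (frontier D)}) hcase,
      indicator_of_notMem (s := {y | infDist y (frontier D) ≤ 4 * ε}) (not_le.2 hcase), add_zero]
    have hδpos : 0 < δ := by linarith
    have hηx : η ε x = 1 := hηone ε hε x hx (by linarith)
    have hsupp : ∀ z ∉ {z | x + z ∈ D ∧ infDist (x + z) (frontier D) ≤ 2 * ε},
        f (x + z) * (η ε (x + z) - η ε x) = 0 := by
      intro z hz
      by_cases hzD : x + z ∈ D
      · have h2 : 2 * ε < infDist (x + z) (frontier D) := by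
          by_contra! h
          exact hz ⟨hzD, h⟩
        rw [hηx, hηone ε hε _ hzD h2, sub_self, mul_zero]
      · rw [hf0 _ hzD, zero_mul]
    have hsize : ∀ z, |f (x + z) * (η ε (x + z) - η ε x)| ≤ M * δ ^ (α / 2) := by
      intro z
      by_cases hz : x + z ∈ D ∧ infDist (x + z) (frontier D) ≤ 2 * ε
      · rw [abs_mul]
        refine (mul_le_mul ((hfb0 _ hz.1).trans ?_) (hηdiff _) (abs_nonneg _)
          (by positivity)).trans (mul_one _).le
        exact mul_le_mul_of_nonneg_left
          (Real.rpow_le_rpow infDist_nonneg (by linarith [hz.2]) (by linarith)) hM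
      · rw [hsupp z hz, abs_zero]
        positivity
    refine (abs_setIntegral_mul_kernel_le_of_support Kbar (by positivity) hKbar.le (by positivity)
      hsize hsupp (hlayer ε hε0 x hx hcase) _).trans ?_
    have hpow : δ ^ (α / 2) * δ ^ (-1 - α) = δ ^ (-1 - α / 2) := by
      rw [← Real.rpow_add hδpos]
      congr 1
      ring
    calc M * δ ^ (α / 2) * Kbar * (C₁ * (ε * δ ^ (-1 - α)))
        = CB * (ε * (δ ^ (α / 2) * δ ^ (-1 - α))) := by rw [hCB]; ring
      _ = CB * (ε * δ ^ (-1 - α / 2)) := by rw [hpow]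
      _ ≤ _ := by
        gcongr
        linarith
  · rw [indicator_of_notMem (s := {y | 4 * ε < infDist y (frontier D)}) (not_lt.2 hcase),
      indicator_of_mem (s := {y | infDist y (frontier D) ≤ 4 * ε}) hcase, zero_add]
    have hηlip : ∀ z, |η ε (x + z) - η ε x| ≤ |c| * ε ^ (-1 : ℝ) * ‖z‖ := by
      intro z
      have h := convex_univ.norm_image_sub_le_of_norm_fderiv_le (𝕜 := ℝ) (f := η ε)
        (C := |c| * ε ^ (-1 : ℝ)) (fun y _ => hηc.differentiable (by norm_num) y)
        (fun y _ => by
          have h := hη1 ε hε 1 le_rfl (by norm_num) y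
          rwa [norm_iteratedFDeriv_one, Nat.cast_one] at h) (mem_univ x) (mem_univ (x + z))
      rwa [add_sub_cancel_left, Real.norm_eq_abs] at h
    have hη2 : ∀ y, ‖fderiv ℝ (fderiv ℝ (η ε)) y‖ ≤ |c| * ε ^ (-2 : ℝ) := by
      intro y
      have h := hη1 ε hε 2 (by norm_num) (by norm_num) y
      rwa [← norm_iteratedFDeriv_fderiv, norm_iteratedFDeriv_one, Nat.cast_ofNat] at h
    have hΓ := abs_setIntegral_mul_kernel_le Kbar hd hKbar.le (α := α)
      (u := fun z => (f (x + z) - f x) * (η ε (x + z) - η ε x))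
      (P := 6 * M * |c| * ε ^ (-1 : ℝ)) (Q := 6 * M) (ρ := ε) (σ := 1 + α / 2) (τ := α / 2)
      (by positivity) (by positivity) hε0 (by linarith) (by linarith) (by linarith)
      (fun z _ => by
        rw [abs_mul]
        refine (mul_le_mul (hhol x hx z) (hηlip z) (abs_nonneg _) (by positivity)).trans
          (le_of_eq ?_)
        rw [Real.rpow_add' (norm_nonneg z) (by positivity), Real.rpow_one]
        ring)
      (fun z _ => by
        rw [abs_mul]
        exact (mul_le_mul (hhol x hx z) (hηdiff _) (abs_nonneg _) (by positivity)).trans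
          (mul_one _).le)
      {z | r < ‖z‖}
    have hL := abs_setIntegral_sub_mul_kernel_le Kbar hd ⟨hα0, hα2⟩ hKbar.le hηc (hη01 ε hε) hη2
      hε0 x hr
    have hfx : |f x| ≤ 4 * M * ε ^ (α / 2) := by
      have h4 : (4 * ε) ^ (α / 2) ≤ 4 * ε ^ (α / 2) := by
        rw [Real.mul_rpow (by norm_num) hε0.le]
        gcongr
        calc (4 : ℝ) ^ (α / 2) ≤ 4 ^ (1 : ℝ) :=
              Real.rpow_le_rpow_of_exponent_le (by norm_num) (by linarith)
          _ = 4 := Real.rpow_one 4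
      calc |f x| ≤ M * δ ^ (α / 2) := hfb0 x hx
        _ ≤ M * (4 * ε ^ (α / 2)) := by
          gcongr
          exact (Real.rpow_le_rpow hδ0 hcase (by linarith)).trans h4
        _ = _ := by ring
    have hi1 := integrableOn_mul_kernel Kbar hd hα0
      (u := fun z => (f (x + z) - f x) * (η ε (x + z) - η ε x)) (B := (B + B) * 1) (by fun_prop)
      (fun z => by
        rw [abs_mul]
        exact mul_le_mul ((abs_sub _ _).trans (add_le_add (hfB _) (hfB _))) (hηdiff _)
          (abs_nonneg _) (by positivity)) hr
    have hi2 := integrableOn_mul_kernel Kbar hd hα0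
      (u := fun z => η ε (x + z) - η ε x) (by fun_prop) (fun z => hηdiff _) hr
    have hsplit : (∫ z in {z : EuclideanSpace ℝ (Fin d) | r < ‖z‖},
          f (x + z) * (η ε (x + z) - η ε x) * Kbar * ‖z‖ ^ (-((d : ℝ) + α))) =
        (∫ z in {z : EuclideanSpace ℝ (Fin d) | r < ‖z‖},
          (f (x + z) - f x) * (η ε (x + z) - η ε x) * Kbar * ‖z‖ ^ (-((d : ℝ) + α))) +
        f x * ∫ z in {z : EuclideanSpace ℝ (Fin d) | r < ‖z‖},
          (η ε (x + z) - η ε x) * Kbar * ‖z‖ ^ (-((d : ℝ) + α)) := by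
      rw [← integral_const_mul, ← integral_add hi1 (hi2.const_mul _)]
      congr 1
      ext z
      ring
    have hΓ' : V * Kbar * (6 * M * |c| * ε ^ (-1 : ℝ) / (1 + α / 2 - α) * ε ^ (1 + α / 2 - α) +
        6 * M / (α - α / 2) * ε ^ (α / 2 - α)) = CΓ * ε ^ (-(α / 2)) := by
      have e1 : ε ^ (1 + α / 2 - α) = ε * ε ^ (-(α / 2)) := by
        rw [mul_comm, ← Real.rpow_add_one hε0.ne']
        congr 1
        ring
      have e2 : ε ^ (α / 2 - α) = ε ^ (-(α / 2)) := by
        congr 1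
        ring
      rw [e1, e2, Real.rpow_neg_one, hCΓ]
      field_simp
    have hL' : 4 * M * ε ^ (α / 2) * (V * Kbar * (|c| * ε ^ (-2 : ℝ) / (2 - α) * ε ^ (2 - α) +
        1 / α * ε ^ (-α))) = CL * ε ^ (-(α / 2)) := by
      have e1 : ε ^ (-2 : ℝ) * ε ^ (2 - α) = ε ^ (-α) := by
        rw [← Real.rpow_add hε0]
        congr 1
        ring
      have e2 : ε ^ (α / 2) * ε ^ (-α) = ε ^ (-(α / 2)) := by
        rw [← Real.rpow_add hε0]
        congr 1
        ring
      calc _ = 4 * M * ε ^ (α / 2) * (V * Kbar * (|c| / (2 - α) * (ε ^ (-2 : ℝ) * ε ^ (2 - α)) +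
            1 / α * ε ^ (-α))) := by ring
        _ = CL * (ε ^ (α / 2) * ε ^ (-α)) := by rw [e1, hCL]; ring
        _ = _ := by rw [e2]
    rw [hsplit]
    calc _ ≤ CΓ * ε ^ (-(α / 2)) + CL * ε ^ (-(α / 2)) := by
          refine (abs_add_le _ _).trans (add_le_add (hΓ.trans hΓ'.le) ?_)
          rw [abs_mul]
          exact (mul_le_mul hfx hL (abs_nonneg _) (by positivity)).trans hL'.le
      _ ≤ (CΓ + CL + CB + 1) * ε ^ (-(α / 2)) := by
          have : 0 ≤ (CB + 1) * ε ^ (-(α / 2)) := by positivity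
          linarith
end
end
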